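/- arXiv:0707.3607 — 5 statements merged into one kernel-verified Lean document; each statement's English description precedes it below -/
import Mathlib

section
/- Let Γ = (G,|.|) be a finite generalized layered graph whose underlying directed graph G = (V,E) is a rooted tree: there is a root * with |*| = 0 and no outgoing edge, every other vertex has exactly one outgoing edge, and every vertex has a directed path to *. For j ≥ 1 let m_j be the number of edges e ∈ E with l(e) ≥ j, and let r be the maximal edge length. Then, as formal power series over ℤ, H(A(Γ),z) · (1 − Σ_{j=1}^r m_j z^j) = 1. -/
open scoped BigOperators

namespace GLG

variable {V E : Type}

def len (tl hd : E → V) (rk : V → ℕ) (e : E) : ℕ := rk (tl e) - rk (hd e)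
def IsRank (tl hd : E → V) (rk : V → ℕ) : Prop := ∀ e : E, rk (hd e) < rk (tl e)
def IsPathC (tl hd : E → V) (e : E) (es : List E) : Prop :=
  List.Chain (fun a b => hd a = tl b) e es
def pathDst (hd : E → V) (e : E) (es : List E) : V :=
  hd ((e :: es).getLast (List.cons_ne_nil e es))
def Reaches (tl hd : E → V) (v w : V) : Prop :=
  ∃ (e : E) (es : List E), IsPathC tl hd e es ∧ tl e = v ∧ pathDst hd e es = w

/-- The set `E^♯` of generators `a_i(e)`, `1 ≤ i ≤ l(e)`. -/
abbrev ESharp (tl hd : E → V) (rk : V → ℕ) : Type :=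
  Σ e : E, {i : ℕ // 1 ≤ i ∧ i ≤ len tl hd rk e}

/-- `P_e(t) = 1 + Σ_{j=1}^{l(e)} (-1)^j a_j(e) t^j`. -/
noncomputable def Pe (F : Type) [Field F] (tl hd : E → V) (rk : V → ℕ) (e : E) :
    Polynomial (FreeAlgebra F (ESharp tl hd rk)) :=
  1 + ∑ j ∈ (Finset.Icc 1 (len tl hd rk e)).attach,
      Polynomial.C ((-1 : FreeAlgebra F (ESharp tl hd rk)) ^ (j : ℕ) *
        FreeAlgebra.ι F (⟨e, ⟨(j : ℕ), (Finset.mem_Icc.mp j.2).1, (Finset.mem_Icc.mp j.2).2⟩⟩ :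
          ESharp tl hd rk)) *
      Polynomial.X ^ (j : ℕ)

/-- `e(π, j)`, the coefficient of `(-t)^j` in `P_π(t) = P_{e₁}(t) ⋯ P_{e_r}(t)`,
for `π` the path given by the list of edges `es`. -/
noncomputable def eP (F : Type) [Field F] (tl hd : E → V) (rk : V → ℕ)
    (es : List E) (j : ℕ) : FreeAlgebra F (ESharp tl hd rk) :=
  (-1 : FreeAlgebra F (ESharp tl hd rk)) ^ j * ((es.map (Pe F tl hd rk)).prod).coeff j

/-- The defining relations of `A(Γ)`: `e(π₁,j) = e(π₂,j)` for paths `π₁, π₂` with the same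
tail and the same head, and `1 ≤ j ≤ l(π₁)`. -/
def rel (F : Type) [Field F] (tl hd : E → V) (rk : V → ℕ) :
    FreeAlgebra F (ESharp tl hd rk) → FreeAlgebra F (ESharp tl hd rk) → Prop :=
  fun x y => ∃ (e1 : E) (es1 : List E) (e2 : E) (es2 : List E) (j : ℕ),
    IsPathC tl hd e1 es1 ∧ IsPathC tl hd e2 es2 ∧
    tl e1 = tl e2 ∧ pathDst hd e1 es1 = pathDst hd e2 es2 ∧
    1 ≤ j ∧ j ≤ rk (tl e1) - rk (pathDst hd e1 es1) ∧
    x = eP F tl hd rk (e1 :: es1) j ∧ y = eP F tl hd rk (e2 :: es2) j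

/-- The algebra `A(Γ) = T(E^♯)/R`. -/
noncomputable abbrev AGamma (F : Type) [Field F] (tl hd : E → V) (rk : V → ℕ) : Type :=
  RingQuot (rel F tl hd rk)

/-- The canonical projection `T(E^♯) → A(Γ)`. -/
noncomputable def mkA (F : Type) [Field F] (tl hd : E → V) (rk : V → ℕ) :
    FreeAlgebra F (ESharp tl hd rk) →ₐ[F] AGamma F tl hd rk :=
  RingQuot.mkAlgHom F (rel F tl hd rk)

/-- `f(a,j) = ja - j(j-1)/2`. -/
def fN (a j : ℕ) : ℕ := j * a - j * (j - 1) / 2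

/-- The filtration weight `|a_i(e)| = f(|t(e)|, i)` of a generator. -/
def wt (tl hd : E → V) (rk : V → ℕ) (s : ESharp tl hd rk) : ℕ := fN (rk (tl s.1)) s.2.1

/-- The filtration subspace `A(Γ)_n`: the span of the images of the products of generators
of total weight at most `n`. -/
noncomputable def filt (F : Type) [Field F] (tl hd : E → V) (rk : V → ℕ) (n : ℕ) :
    Submodule F (AGamma F tl hd rk) :=
  Submodule.span F {x : AGamma F tl hd rk | ∃ w : List (ESharp tl hd rk),
    (w.map (wt tl hd rk)).sum ≤ n ∧ x = mkA F tl hd rk ((w.map (FreeAlgebra.ι F)).prod)}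

/-- The degree-`n` homogeneous component `A(Γ)_{[n]}` (for the grading with `deg a_i(e) = i`):
the image in `A(Γ)` of the span of the words of total degree `n`. -/
noncomputable def gpiece (F : Type) [Field F] (tl hd : E → V) (rk : V → ℕ) (n : ℕ) :
    Submodule F (AGamma F tl hd rk) :=
  Submodule.span F {x : AGamma F tl hd rk | ∃ w : List (ESharp tl hd rk),
    (w.map (fun s => s.2.1)).sum = n ∧ x = mkA F tl hd rk ((w.map (FreeAlgebra.ι F)).prod)}

/-- The Hilbert series `H(A(Γ), z) = Σ_n dim_F A(Γ)_{[n]} · z^n ∈ ℤ[[z]]`. -/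
noncomputable def hilb (F : Type) [Field F] (tl hd : E → V) (rk : V → ℕ) : PowerSeries ℤ :=
  PowerSeries.mk fun n => (Module.finrank F (gpiece F tl hd rk n) : ℤ)


/-- `v ≥ w` in the poset of the graph. -/
def GE (tl hd : E → V) (v w : V) : Prop := v = w ∨ Reaches tl hd v w

/-- The Möbius function of the poset of the graph: the sum of `(-1)^(l+1)` over all
chains `v = v₁ > v₂ > ⋯ > v_l = w`. -/
noncomputable def mob (tl hd : E → V) (v w : V) : ℤ :=
  ∑ᶠ c ∈ {c : List V | c.Chain' (Reaches tl hd) ∧ c.head? = some v ∧ c.getLast? = some w},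
    (-1 : ℤ) ^ (c.length + 1)

/-- `M(Γ)(z) = Σ_{v ≥ w} μ(v,w) z^{|v|-|w|}`, as a formal power series over `ℤ`. -/
noncomputable def MGamma (tl hd : E → V) (rk : V → ℕ) : PowerSeries ℤ :=
  ∑ᶠ p ∈ {p : V × V | GE tl hd p.1 p.2},
    mob tl hd p.1 p.2 • (PowerSeries.X : PowerSeries ℤ) ^ (rk p.1 - rk p.2)

/-- `M_∘(Γ)(z) = Σ_{x ∈ V} μ(x, v_min) z^{|x|-|v_min|}`. -/
noncomputable def MLow (tl hd : E → V) (rk : V → ℕ) (vmin : V) : PowerSeries ℤ :=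
  ∑ᶠ x : V, mob tl hd x vmin • (PowerSeries.X : PowerSeries ℤ) ^ (rk x - rk vmin)

noncomputable def MUp (tl hd : E → V) (rk : V → ℕ) (vmax : V) : PowerSeries ℤ :=
  ∑ᶠ x : V, mob tl hd vmax x • (PowerSeries.X : PowerSeries ℤ) ^ (rk vmax - rk x)

end GLG

namespace GLG

variable {V E : Type}

def dg (tl hd : E → V) (rk : V → ℕ) (w : List (ESharp tl hd rk)) : ℕ :=
  (w.map (fun s => s.2.1)).sum

theorem chain_rank (tl hd : E → V) (rk : V → ℕ) (hrank : IsRank tl hd rk) (es : List E) :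
    ∀ e : E, IsPathC tl hd e es → rk (pathDst hd e es) < rk (tl e) := by
  induction es with
  | nil => intro e _; exact hrank e
  | cons a as ih =>
    intro e h
    have h' : hd e = tl a ∧ IsPathC tl hd a as := List.isChain_cons_cons.mp h
    have h1 := ih a h'.2
    have h2 := hrank e
    have h3 : pathDst hd e (a :: as) = pathDst hd a as := by simp [pathDst]
    rw [h3]
    rw [h'.1] at h2
    omega

theorem path_unique (tl hd : E → V) (rk : V → ℕ) (hrank : IsRank tl hd rk)
    (hinj : ∀ e e' : E, tl e = tl e' → e = e') (es1 : List E) :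
    ∀ (es2 : List E) (e : E), IsPathC tl hd e es1 → IsPathC tl hd e es2 →
      pathDst hd e es1 = pathDst hd e es2 → es1 = es2 := by
  induction es1 with
  | nil =>
    intro es2 e _ h2 h
    cases es2 with
    | nil => rfl
    | cons a as =>
      exfalso
      have h' : hd e = tl a ∧ IsPathC tl hd a as := List.isChain_cons_cons.mp h2
      have h1 := chain_rank tl hd rk hrank as a h'.2
      have h3 : pathDst hd e (a :: as) = pathDst hd a as := by simp [pathDst]
      have h4 : pathDst hd e [] = hd e := rfl
      rw [h3, h4, h'.1] at h
      rw [h] at h1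
      omega
  | cons b bs ih =>
    intro es2 e h1 h2 h
    have h1' : hd e = tl b ∧ IsPathC tl hd b bs := List.isChain_cons_cons.mp h1
    have h3' : pathDst hd e (b :: bs) = pathDst hd b bs := by simp [pathDst]
    cases es2 with
    | nil =>
      exfalso
      have h1 := chain_rank tl hd rk hrank bs b h1'.2
      have h4 : pathDst hd e [] = hd e := rfl
      rw [h3', h4, h1'.1] at h
      rw [h] at h1
      omega
    | cons a as =>
      have h' : hd e = tl a ∧ IsPathC tl hd a as := List.isChain_cons_cons.mp h2
      have h3 : pathDst hd e (a :: as) = pathDst hd a as := by simp [pathDst]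
      have hab : b = a := hinj _ _ (h1'.1.symm.trans h'.1)
      subst hab
      rw [ih as b h1'.2 h'.2 (by rw [← h3', ← h3, h])]

theorem mkA_inj (F : Type) [Field F] (tl hd : E → V) (rk : V → ℕ) (hrank : IsRank tl hd rk)
    (hinj : ∀ e e' : E, tl e = tl e' → e = e') : Function.Injective (mkA F tl hd rk) := by
  have hrel : ∀ ⦃x y⦄, rel F tl hd rk x y →
      AlgHom.id F (FreeAlgebra F (ESharp tl hd rk)) x = AlgHom.id F _ y := by
    rintro x y ⟨e1, es1, e2, es2, j, p1, p2, ht, hh, -, -, rfl, rfl⟩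
    obtain rfl := hinj _ _ ht
    rw [path_unique tl hd rk hrank hinj es1 es2 e1 p1 p2 hh]
  apply Function.LeftInverse.injective
    (g := RingQuot.liftAlgHom F ⟨AlgHom.id F (FreeAlgebra F (ESharp tl hd rk)), hrel⟩)
  intro x
  simp [mkA]

theorem words_li (F : Type) [Field F] (X : Type) :
    LinearIndependent F (fun w : List X => (w.map (FreeAlgebra.ι F)).prod) := by
  have h := (FreeAlgebra.basisFreeMonoid F X).linearIndependent
  have key : (fun w : List X => (w.map (FreeAlgebra.ι F)).prod) =
      (FreeAlgebra.basisFreeMonoid F X : FreeMonoid X → FreeAlgebra F X) := by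
    funext w
    have h2 : FreeAlgebra.basisFreeMonoid F X (FreeMonoid.ofList w) =
        FreeAlgebra.equivMonoidAlgebraFreeMonoid.symm
          (MonoidAlgebra.of F (FreeMonoid X) (FreeMonoid.ofList w)) := by
      simp [FreeAlgebra.basisFreeMonoid]
    refine Eq.trans ?_ h2.symm
    rw [AlgEquiv.eq_symm_apply, map_list_prod, List.map_map]
    clear h2
    induction w with
    | nil => rw [List.map_nil, List.prod_nil, FreeMonoid.ofList_nil, map_one]
    | cons a as ih =>
      rw [List.map_cons, List.prod_cons, ih, FreeMonoid.ofList_cons, map_mul]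
      simp [FreeAlgebra.equivMonoidAlgebraFreeMonoid]
  rw [key]
  exact h

theorem finite_words [Finite E] (tl hd : E → V) (rk : V → ℕ) (n : ℕ) :
    Finite {w : List (ESharp tl hd rk) // dg tl hd rk w = n} := by
  have : ∀ e : E, Finite {i : ℕ // 1 ≤ i ∧ i ≤ len tl hd rk e} := fun e =>
    (Set.finite_Icc 1 (len tl hd rk e)).to_subtype
  have hl : ∀ w : List (ESharp tl hd rk), w.length ≤ dg tl hd rk w := by
    intro w
    induction w with
    | nil => simp
    | cons a as ih =>
      have := a.2.2.1
      simp [dg] at ih ⊢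
      omega
  exact ((List.finite_length_le (ESharp tl hd rk) n).subset
    (fun w (hw : dg tl hd rk w = n) => hw ▸ hl w)).to_subtype

theorem finrank_gpiece (F : Type) [Field F] [Finite E] (tl hd : E → V) (rk : V → ℕ)
    (hrank : IsRank tl hd rk)
    (hinj : ∀ e e' : E, tl e = tl e' → e = e') (n : ℕ) :
    Module.finrank F (gpiece F tl hd rk n) =
      Nat.card {w : List (ESharp tl hd rk) // dg tl hd rk w = n} := by
  have := finite_words tl hd rk n
  have := Fintype.ofFinite {w : List (ESharp tl hd rk) // dg tl hd rk w = n}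
  have h1 := ((words_li F (ESharp tl hd rk)).map' (mkA F tl hd rk).toLinearMap
    (LinearMap.ker_eq_bot.mpr (mkA_inj F tl hd rk hrank hinj))).comp
    (fun w : {w : List (ESharp tl hd rk) // dg tl hd rk w = n} => w.1) Subtype.val_injective
  have h2 := finrank_span_eq_card h1
  rw [Nat.card_eq_fintype_card, ← h2]
  have : gpiece F tl hd rk n = Submodule.span F (Set.range (((mkA F tl hd rk).toLinearMap ∘
    fun w : List (ESharp tl hd rk) => (w.map (FreeAlgebra.ι F)).prod) ∘
    (fun w : {w : List (ESharp tl hd rk) // dg tl hd rk w = n} => w.1))) := by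
    unfold gpiece
    congr 1
    ext x
    constructor
    · rintro ⟨w, hw, rfl⟩
      exact ⟨⟨w, hw⟩, rfl⟩
    · rintro ⟨⟨w, hw⟩, rfl⟩
      exact ⟨w, hw, rfl⟩
  rw [this]

def splitEquiv (tl hd : E → V) (rk : V → ℕ) (n : ℕ) (hn : n ≠ 0) :
    {w : List (ESharp tl hd rk) // dg tl hd rk w = n} ≃
      Σ s : ESharp tl hd rk, {w : List (ESharp tl hd rk) // s.2.1 + dg tl hd rk w = n} where
  toFun w := match w with
    | ⟨[], h⟩ => absurd h.symm hn
    | ⟨a :: as, h⟩ => ⟨a, as, by simpa [dg] using h⟩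
  invFun p := ⟨p.1 :: p.2.1, by simpa [dg] using p.2.2⟩
  left_inv w := match w with
    | ⟨[], h⟩ => absurd h.symm hn
    | ⟨a :: as, h⟩ => rfl
  right_inv p := rfl

theorem card_shift (tl hd : E → V) (rk : V → ℕ) (n j : ℕ) :
    Nat.card {w : List (ESharp tl hd rk) // j + dg tl hd rk w = n} =
      if j ≤ n then Nat.card {w : List (ESharp tl hd rk) // dg tl hd rk w = n - j} else 0 := by
  split_ifs with h
  · apply Nat.card_congr
    exact Equiv.subtypeEquivRight (fun w => by omega)
  · have : IsEmpty {w : List (ESharp tl hd rk) // j + dg tl hd rk w = n} :=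
      ⟨fun w => by have := w.2; omega⟩
    simp

theorem card_rec [Fintype E] (tl hd : E → V) (rk : V → ℕ) (r : ℕ)
    (hr : ∀ e : E, len tl hd rk e ≤ r) (n : ℕ) (hn : n ≠ 0) :
    Nat.card {w : List (ESharp tl hd rk) // dg tl hd rk w = n} =
      ∑ j ∈ Finset.Icc 1 r, Nat.card {e : E // j ≤ len tl hd rk e} *
        if j ≤ n then Nat.card {w : List (ESharp tl hd rk) // dg tl hd rk w = n - j} else 0 := by
  classical
  have : ∀ e : E, Finite {i : ℕ // 1 ≤ i ∧ i ≤ len tl hd rk e} := fun e =>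
    (Set.finite_Icc 1 (len tl hd rk e)).to_subtype
  have := Fintype.ofFinite (ESharp tl hd rk)
  have hf : ∀ s : ESharp tl hd rk,
      Finite {w : List (ESharp tl hd rk) // s.2.1 + dg tl hd rk w = n} := by
    intro s
    have := finite_words tl hd rk (n - s.2.1)
    exact Finite.of_injective (β := {w : List (ESharp tl hd rk) // dg tl hd rk w = n - s.2.1})
      (fun w => ⟨w.1, by have := w.2; omega⟩)
      (fun a b h => Subtype.ext (Subtype.mk.inj h))
  rw [Nat.card_congr (splitEquiv tl hd rk n hn), Nat.card_sigma]
  simp only [card_shift]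
  rw [← Finset.sum_fiberwise_of_maps_to (s := Finset.univ) (t := Finset.Icc 1 r)
    (g := fun s : ESharp tl hd rk => s.2.1)
    (fun s _ => Finset.mem_Icc.mpr ⟨s.2.2.1, s.2.2.2.trans (hr _)⟩)]
  apply Finset.sum_congr rfl
  intro j hj
  rw [Finset.sum_congr rfl (g := fun _ => if j ≤ n then
    Nat.card {w : List (ESharp tl hd rk) // dg tl hd rk w = n - j} else 0)
    (fun s hs => by rw [(Finset.mem_filter.mp hs).2])]
  rw [Finset.sum_const, smul_eq_mul]
  congr 1
  rw [← Fintype.card_subtype, ← Nat.card_eq_fintype_card]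
  apply Nat.card_congr
  have hj1 := (Finset.mem_Icc.mp hj).1
  exact
  { toFun := fun s => ⟨s.1.1, by have := s.1.2.2.2; have := s.2; omega⟩
    invFun := fun e => ⟨⟨e.1, j, hj1, e.2⟩, rfl⟩
    left_inv := by rintro ⟨⟨e, i, h⟩, rfl⟩; rfl
    right_inv := fun e => rfl }

theorem card_zero (tl hd : E → V) (rk : V → ℕ) :
    Nat.card {w : List (ESharp tl hd rk) // dg tl hd rk w = 0} = 1 := by
  rw [Nat.card_eq_one_iff_exists]
  refine ⟨⟨[], rfl⟩, ?_⟩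
  rintro ⟨_ | ⟨a, as⟩, h⟩
  · rfl
  · have := a.2.2.1
    simp [dg] at h
    omega

end GLG

/-- **Corollary 4.3.** Let `Γ` be a finite generalized layered graph whose
underlying directed graph is a rooted tree with root `*` of rank `0`: the root has no
outgoing edge, every other vertex has exactly one outgoing edge, and every vertex other
than the root has a directed path to the root.  For `j ≥ 1` let `m_j` be the number of
edges of length `≥ j`, and let `r` be the maximal edge length.  Then
`H(A(Γ),z) · (1 - Σ_{j=1}^r m_j z^j) = 1`. -/
theorem hilbert_series_tree (F : Type) [Field F] {V E : Type} [Fintype V] [Fintype E]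
    (tl hd : E → V) (rk : V → ℕ) (hrank : GLG.IsRank tl hd rk)
    (star : V) (hstar0 : rk star = 0)
    (hroot : ∀ e : E, tl e ≠ star)
    (hout : ∀ v : V, v ≠ star → ∃! e : E, tl e = v)
    (hconn : ∀ v : V, v ≠ star → GLG.Reaches tl hd v star)
    (r : ℕ) (hr : ∀ e : E, GLG.len tl hd rk e ≤ r)
    (hrmax : r = 0 ∨ ∃ e : E, GLG.len tl hd rk e = r) :
    GLG.hilb F tl hd rk *
        (1 - ∑ j ∈ Finset.Icc 1 r,
          (Nat.card {e : E // j ≤ GLG.len tl hd rk e} : ℤ) •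
            (PowerSeries.X : PowerSeries ℤ) ^ j) = 1 := by
  have hinj : ∀ e e' : E, tl e = tl e' → e = e' := fun e e' h =>
    (hout (tl e') (hroot e')).unique h rfl
  ext n
  rw [mul_sub, mul_one, map_sub, Finset.mul_sum, map_sum]
  simp only [mul_smul_comm, map_smul, map_zsmul, PowerSeries.coeff_smul, PowerSeries.coeff_mul_X_pow', GLG.hilb, PowerSeries.coeff_mk,
    GLG.finrank_gpiece F tl hd rk hrank hinj, PowerSeries.coeff_one]
  by_cases hn : n = 0
  · subst hn
    rw [GLG.card_zero, Finset.sum_eq_zero]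
    · simp
    · intro j hj
      have := (Finset.mem_Icc.mp hj).1
      rw [if_neg (by omega), smul_zero]
  · rw [GLG.card_rec tl hd rk r hr n hn, if_neg hn]
    push_cast
    simp
end

section
/- Let Γ_1 and Γ_2 be finite generalized layered graphs with unique minimal vertices *_1 and *_2, both of rank 0, and let Γ_1 ∨ Γ_2 be the bouquet obtained from the disjoint union of Γ_1 and Γ_2 by identifying *_1 with *_2. Then A(Γ_1 ∨ Γ_2) is isomorphic as an F-algebra to the coproduct (free product) of A(Γ_1) and A(Γ_2) in the category of associative unital F-algebras. -/
open scoped BigOperators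

namespace GLG

variable {V1 E1 V2 E2 : Type}

/-- Vertex set of the bouquet `Γ₁ ∨ Γ₂`: the vertices of `Γ₁` other than `*₁`, the vertices
of `Γ₂` other than `*₂`, and the common minimal vertex `none`. -/
abbrev BqV (V1 V2 : Type) (s1 : V1) (s2 : V2) : Type :=
  Option ({v : V1 // v ≠ s1} ⊕ {v : V2 // v ≠ s2})

open Classical in
/-- The embedding of the vertices of `Γ₁` into the bouquet. -/
noncomputable def bqEmb1 (s1 : V1) (s2 : V2) : V1 → BqV V1 V2 s1 s2 :=
  fun v => if h : v = s1 then none else some (Sum.inl ⟨v, h⟩)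

open Classical in
/-- The embedding of the vertices of `Γ₂` into the bouquet. -/
noncomputable def bqEmb2 (s1 : V1) (s2 : V2) : V2 → BqV V1 V2 s1 s2 :=
  fun v => if h : v = s2 then none else some (Sum.inr ⟨v, h⟩)

/-- Tail map of the bouquet. -/
noncomputable def bqTl (tl1 : E1 → V1) (tl2 : E2 → V2) (s1 : V1) (s2 : V2) :
    E1 ⊕ E2 → BqV V1 V2 s1 s2 :=
  Sum.elim (fun e => bqEmb1 s1 s2 (tl1 e)) (fun e => bqEmb2 s1 s2 (tl2 e))

/-- Head map of the bouquet. -/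
noncomputable def bqHd (hd1 : E1 → V1) (hd2 : E2 → V2) (s1 : V1) (s2 : V2) :
    E1 ⊕ E2 → BqV V1 V2 s1 s2 :=
  Sum.elim (fun e => bqEmb1 s1 s2 (hd1 e)) (fun e => bqEmb2 s1 s2 (hd2 e))

/-- Rank function of the bouquet. -/
def bqRk (rk1 : V1 → ℕ) (rk2 : V2 → ℕ) (s1 : V1) (s2 : V2) : BqV V1 V2 s1 s2 → ℕ
  | none => 0
  | some (Sum.inl v) => rk1 v.1
  | some (Sum.inr v) => rk2 v.1

theorem bqRk_emb1 {rk1 : V1 → ℕ} {rk2 : V2 → ℕ} {s1 : V1} {s2 : V2} (hs1 : rk1 s1 = 0)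
    (v : V1) : bqRk rk1 rk2 s1 s2 (bqEmb1 s1 s2 v) = rk1 v := by
  unfold bqEmb1
  split_ifs with h
  · subst h; exact hs1.symm
  · rfl

theorem bqRk_emb2 {rk1 : V1 → ℕ} {rk2 : V2 → ℕ} {s1 : V1} {s2 : V2} (hs2 : rk2 s2 = 0)
    (v : V2) : bqRk rk1 rk2 s1 s2 (bqEmb2 s1 s2 v) = rk2 v := by
  unfold bqEmb2
  split_ifs with h
  · subst h; exact hs2.symm
  · rfl

/-- The map on generators inducing the canonical homomorphism `A(Γ₁) → A(Γ₁ ∨ Γ₂)`. -/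
noncomputable def bqGen1 (F : Type) [Field F] (tl1 hd1 : E1 → V1) (rk1 : V1 → ℕ)
    (tl2 hd2 : E2 → V2) (rk2 : V2 → ℕ) (s1 : V1) (s2 : V2) (hs1 : rk1 s1 = 0) :
    ESharp tl1 hd1 rk1 →
      FreeAlgebra F (ESharp (bqTl tl1 tl2 s1 s2) (bqHd hd1 hd2 s1 s2) (bqRk rk1 rk2 s1 s2)) :=
  fun s => FreeAlgebra.ι F ⟨Sum.inl s.1, ⟨s.2.1, s.2.2.1, by
    have h := s.2.2.2
    unfold len at h ⊢
    rw [show bqTl tl1 tl2 s1 s2 (Sum.inl s.1) = bqEmb1 s1 s2 (tl1 s.1) from rfl,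
      show bqHd hd1 hd2 s1 s2 (Sum.inl s.1) = bqEmb1 s1 s2 (hd1 s.1) from rfl,
      bqRk_emb1 hs1, bqRk_emb1 hs1]
    exact h⟩⟩

/-- The map on generators inducing the canonical homomorphism `A(Γ₂) → A(Γ₁ ∨ Γ₂)`. -/
noncomputable def bqGen2 (F : Type) [Field F] (tl1 hd1 : E1 → V1) (rk1 : V1 → ℕ)
    (tl2 hd2 : E2 → V2) (rk2 : V2 → ℕ) (s1 : V1) (s2 : V2) (hs2 : rk2 s2 = 0) :
    ESharp tl2 hd2 rk2 →
      FreeAlgebra F (ESharp (bqTl tl1 tl2 s1 s2) (bqHd hd1 hd2 s1 s2) (bqRk rk1 rk2 s1 s2)) :=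
  fun s => FreeAlgebra.ι F ⟨Sum.inr s.1, ⟨s.2.1, s.2.2.1, by
    have h := s.2.2.2
    unfold len at h ⊢
    rw [show bqTl tl1 tl2 s1 s2 (Sum.inr s.1) = bqEmb2 s1 s2 (tl2 s.1) from rfl,
      show bqHd hd1 hd2 s1 s2 (Sum.inr s.1) = bqEmb2 s1 s2 (hd2 s.1) from rfl,
      bqRk_emb2 hs2, bqRk_emb2 hs2]
    exact h⟩⟩

end GLG

namespace GLG

theorem map_Pe {F : Type} [Field F] {V E : Type} (tl hd : E → V) (rk : V → ℕ)
    {B : Type} [Ring B] [Algebra F B] (ψ : FreeAlgebra F (ESharp tl hd rk) →ₐ[F] B) (e : E) :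
    (Pe F tl hd rk e).map (ψ : FreeAlgebra F (ESharp tl hd rk) →+* B) =
      1 + ∑ j ∈ Finset.Icc 1 (len tl hd rk e),
        Polynomial.C ((-1 : B) ^ j *
          (if h : 1 ≤ j ∧ j ≤ len tl hd rk e then ψ (FreeAlgebra.ι F ⟨e, ⟨j, h⟩⟩) else 0)) *
        Polynomial.X ^ j := by
  classical
  rw [← Finset.sum_attach (Finset.Icc 1 (len tl hd rk e)), Pe, Polynomial.map_add,
    Polynomial.map_one, Polynomial.map_sum]
  congr 1
  refine Finset.sum_congr rfl fun j _ => ?_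
  rw [dif_pos (Finset.mem_Icc.mp j.2)]
  simp [Polynomial.map_mul]

theorem map_eP {F : Type} [Field F] {V E V' E' : Type} (tl hd : E → V) (rk : V → ℕ)
    (tl' hd' : E' → V') (rk' : V' → ℕ) (inc : E → E')
    (hlen : ∀ e, len tl' hd' rk' (inc e) = len tl hd rk e)
    {B : Type} [Ring B] [Algebra F B] (ψ : FreeAlgebra F (ESharp tl' hd' rk') →ₐ[F] B)
    (χ : FreeAlgebra F (ESharp tl hd rk) →ₐ[F] B)
    (H : ∀ e j h h', ψ (FreeAlgebra.ι F ⟨inc e, ⟨j, h⟩⟩) = χ (FreeAlgebra.ι F ⟨e, ⟨j, h'⟩⟩))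
    (es : List E) (j : ℕ) :
    ψ (eP F tl' hd' rk' (es.map inc) j) = χ (eP F tl hd rk es j) := by
  have h1 : ∀ e, (Pe F tl' hd' rk' (inc e)).map (ψ : FreeAlgebra F (ESharp tl' hd' rk') →+* B) =
      (Pe F tl hd rk e).map (χ : FreeAlgebra F (ESharp tl hd rk) →+* B) := by
    intro e
    rw [map_Pe, map_Pe]
    congr 1
    refine Finset.sum_congr (by rw [hlen]) fun j hj => ?_
    have h := Finset.mem_Icc.mp hj
    have h' : 1 ≤ j ∧ j ≤ len tl' hd' rk' (inc e) := by rw [hlen]; exact h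
    rw [dif_pos h, dif_pos h', H e j h' h]
  have h2 : (((es.map inc).map (Pe F tl' hd' rk')).prod).map
        (ψ : FreeAlgebra F (ESharp tl' hd' rk') →+* B) =
      ((es.map (Pe F tl hd rk)).prod).map (χ : FreeAlgebra F (ESharp tl hd rk) →+* B) := by
    induction es with
    | nil => simp
    | cons e es ih =>
      simp only [List.map_cons, List.prod_cons, Polynomial.map_mul]
      rw [ih, h1]
  have h3 := congrArg (fun p => Polynomial.coeff p j) h2
  simp only [Polynomial.coeff_map, RingHom.coe_coe] at h3
  simp only [eP, map_mul, map_pow, map_neg, map_one, h3]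

theorem path_lift {V E V' E' : Type} (tl hd : E → V) (tl' hd' : E' → V') (inc : E → E')
    (emb : V → V') (hemb : Function.Injective emb)
    (htl : ∀ e, tl' (inc e) = emb (tl e)) (hhd : ∀ e, hd' (inc e) = emb (hd e))
    (hcl : ∀ e e', hd' (inc e) = tl' e' → ∃ e0, e' = inc e0) (es : List E') :
    ∀ e : E, IsPathC tl' hd' (inc e) es → ∃ es0 : List E, es = es0.map inc ∧ IsPathC tl hd e es0 ∧
      pathDst hd' (inc e) es = emb (pathDst hd e es0) := by
  induction es with
  | nil => intro e _; exact ⟨[], rfl, List.isChain_singleton e, by simp [pathDst, hhd]⟩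
  | cons a es ih =>
    intro e h
    have h' := List.isChain_cons_cons.mp h
    obtain ⟨a0, rfl⟩ := hcl e a h'.1
    obtain ⟨es0, rfl, hp, hd⟩ := ih a0 h'.2
    refine ⟨a0 :: es0, rfl, List.isChain_cons_cons.mpr ⟨?_, hp⟩, ?_⟩
    · have := h'.1
      rw [htl, hhd] at this
      exact hemb this
    · simpa [pathDst, List.getLast_cons] using hd

theorem rel_lift {F : Type} [Field F] {V E V' E' : Type} (tl hd : E → V) (rk : V → ℕ)
    (tl' hd' : E' → V') (rk' : V' → ℕ) (inc : E → E')
    (emb : V → V') (hemb : Function.Injective emb) (hrk : ∀ v, rk' (emb v) = rk v)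
    (htl : ∀ e, tl' (inc e) = emb (tl e)) (hhd : ∀ e, hd' (inc e) = emb (hd e))
    (hcl : ∀ e e', hd' (inc e) = tl' e' → ∃ e0, e' = inc e0)
    {B : Type} [Ring B] [Algebra F B] (ψ : FreeAlgebra F (ESharp tl' hd' rk') →ₐ[F] B)
    (f : AGamma F tl hd rk →ₐ[F] B)
    (H : ∀ e j h h', ψ (FreeAlgebra.ι F ⟨inc e, ⟨j, h⟩⟩) =
      f (mkA F tl hd rk (FreeAlgebra.ι F ⟨e, ⟨j, h'⟩⟩)))
    (e1 e2 : E) (es1 es2 : List E') (j : ℕ)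
    (hp1 : IsPathC tl' hd' (inc e1) es1) (hp2 : IsPathC tl' hd' (inc e2) es2)
    (ht : tl' (inc e1) = tl' (inc e2))
    (hd12 : pathDst hd' (inc e1) es1 = pathDst hd' (inc e2) es2) (hj : 1 ≤ j)
    (hj' : j ≤ rk' (tl' (inc e1)) - rk' (pathDst hd' (inc e1) es1)) :
    ψ (eP F tl' hd' rk' (inc e1 :: es1) j) = ψ (eP F tl' hd' rk' (inc e2 :: es2) j) := by
  obtain ⟨t1, rfl, hq1, hd1⟩ := path_lift tl hd tl' hd' inc emb hemb htl hhd hcl es1 e1 hp1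
  obtain ⟨t2, rfl, hq2, hd2⟩ := path_lift tl hd tl' hd' inc emb hemb htl hhd hcl es2 e2 hp2
  have hlen : ∀ e, len tl' hd' rk' (inc e) = len tl hd rk e := by
    intro e; simp [len, htl, hhd, hrk]
  have key := map_eP tl hd rk tl' hd' rk' inc hlen ψ (f.comp (mkA F tl hd rk)) H
  rw [← List.map_cons, ← List.map_cons, key, key]
  simp only [AlgHom.comp_apply]
  congr 1
  apply RingQuot.mkAlgHom_rel
  rw [htl, htl] at ht
  rw [hd1, hd2] at hd12
  rw [htl, hd1, hrk, hrk] at hj'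
  exact ⟨e1, t1, e2, t2, j, hq1, hq2, hemb ht, hemb hd12, hj, hj', rfl, rfl⟩

theorem bqEmb1_inj {V1 V2 : Type} (s1 : V1) (s2 : V2) :
    Function.Injective (bqEmb1 s1 s2) := by
  intro a b h
  unfold bqEmb1 at h
  split_ifs at h with h1 h2 h2
  · rw [h1, h2]
  · simpa using h

theorem bqEmb2_inj {V1 V2 : Type} (s1 : V1) (s2 : V2) :
    Function.Injective (bqEmb2 s1 s2) := by
  intro a b h
  unfold bqEmb2 at h
  split_ifs at h with h1 h2 h2
  · rw [h1, h2]
  · simpa using h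

theorem bqEmb_ne {V1 V2 : Type} (s1 : V1) (s2 : V2) (a : V1) (b : V2)
    (h : bqEmb1 s1 s2 a = bqEmb2 s1 s2 b) : a = s1 ∧ b = s2 := by
  unfold bqEmb1 bqEmb2 at h
  split_ifs at h with h1 h2 h2
  · exact ⟨h1, h2⟩
  · simp at h

end GLG

/-- Let `Γ₁`, `Γ₂` be finite generalized layered graphs with unique
minimal vertices `*₁`, `*₂` of rank `0`, and let `Γ₁ ∨ Γ₂` be the bouquet obtained by
identifying `*₁` with `*₂`.  Then `A(Γ₁ ∨ Γ₂)` is the coproduct (free product) of `A(Γ₁)`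
and `A(Γ₂)` in the category of associative unital `F`-algebras: together with the two
canonical homomorphisms `φ₁ : A(Γ₁) → A(Γ₁ ∨ Γ₂)` and `φ₂ : A(Γ₂) → A(Γ₁ ∨ Γ₂)` it
satisfies the universal property of the coproduct. -/
theorem bouquet_is_free_product (F : Type) [Field F] {V1 E1 V2 E2 : Type}
    [Fintype V1] [Fintype E1] [Fintype V2] [Fintype E2]
    (tl1 hd1 : E1 → V1) (rk1 : V1 → ℕ) (hrank1 : GLG.IsRank tl1 hd1 rk1)
    (tl2 hd2 : E2 → V2) (rk2 : V2 → ℕ) (hrank2 : GLG.IsRank tl2 hd2 rk2)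
    (s1 : V1) (hs1 : rk1 s1 = 0) (hmin1 : ∀ v : V1, (∀ e : E1, tl1 e ≠ v) ↔ v = s1)
    (s2 : V2) (hs2 : rk2 s2 = 0) (hmin2 : ∀ v : V2, (∀ e : E2, tl2 e ≠ v) ↔ v = s2)
    (φ1 : GLG.AGamma F tl1 hd1 rk1 →ₐ[F]
      GLG.AGamma F (GLG.bqTl tl1 tl2 s1 s2) (GLG.bqHd hd1 hd2 s1 s2) (GLG.bqRk rk1 rk2 s1 s2))
    (hφ1 : ∀ x : FreeAlgebra F (GLG.ESharp tl1 hd1 rk1),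
      φ1 (GLG.mkA F tl1 hd1 rk1 x) =
        GLG.mkA F (GLG.bqTl tl1 tl2 s1 s2) (GLG.bqHd hd1 hd2 s1 s2) (GLG.bqRk rk1 rk2 s1 s2)
          (FreeAlgebra.lift F (GLG.bqGen1 F tl1 hd1 rk1 tl2 hd2 rk2 s1 s2 hs1) x))
    (φ2 : GLG.AGamma F tl2 hd2 rk2 →ₐ[F]
      GLG.AGamma F (GLG.bqTl tl1 tl2 s1 s2) (GLG.bqHd hd1 hd2 s1 s2) (GLG.bqRk rk1 rk2 s1 s2))
    (hφ2 : ∀ x : FreeAlgebra F (GLG.ESharp tl2 hd2 rk2),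
      φ2 (GLG.mkA F tl2 hd2 rk2 x) =
        GLG.mkA F (GLG.bqTl tl1 tl2 s1 s2) (GLG.bqHd hd1 hd2 s1 s2) (GLG.bqRk rk1 rk2 s1 s2)
          (FreeAlgebra.lift F (GLG.bqGen2 F tl1 hd1 rk1 tl2 hd2 rk2 s1 s2 hs2) x)) :
    ∀ (B : Type) [Ring B] [Algebra F B]
      (f1 : GLG.AGamma F tl1 hd1 rk1 →ₐ[F] B) (f2 : GLG.AGamma F tl2 hd2 rk2 →ₐ[F] B),
      ∃! g : GLG.AGamma F (GLG.bqTl tl1 tl2 s1 s2) (GLG.bqHd hd1 hd2 s1 s2)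
          (GLG.bqRk rk1 rk2 s1 s2) →ₐ[F] B,
        g.comp φ1 = f1 ∧ g.comp φ2 = f2 := by
  intro B _ _ f1 f2
  have ht1 : ∀ e, tl1 e ≠ s1 := (hmin1 s1).mpr rfl
  have ht2 : ∀ e, tl2 e ≠ s2 := (hmin2 s2).mpr rfl
  have hl1 : ∀ e, GLG.len (GLG.bqTl tl1 tl2 s1 s2) (GLG.bqHd hd1 hd2 s1 s2)
      (GLG.bqRk rk1 rk2 s1 s2) (Sum.inl e) = GLG.len tl1 hd1 rk1 e := by
    intro e
    simp [GLG.len, GLG.bqTl, GLG.bqHd, GLG.bqRk_emb1 hs1]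
  have hl2 : ∀ e, GLG.len (GLG.bqTl tl1 tl2 s1 s2) (GLG.bqHd hd1 hd2 s1 s2)
      (GLG.bqRk rk1 rk2 s1 s2) (Sum.inr e) = GLG.len tl2 hd2 rk2 e := by
    intro e
    simp [GLG.len, GLG.bqTl, GLG.bqHd, GLG.bqRk_emb2 hs2]
  let gen : GLG.ESharp (GLG.bqTl tl1 tl2 s1 s2) (GLG.bqHd hd1 hd2 s1 s2)
      (GLG.bqRk rk1 rk2 s1 s2) → B := fun s => match s with
    | ⟨Sum.inl e, ⟨j, h⟩⟩ =>
        f1 (GLG.mkA F tl1 hd1 rk1 (FreeAlgebra.ι F ⟨e, ⟨j, h.1, hl1 e ▸ h.2⟩⟩))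
    | ⟨Sum.inr e, ⟨j, h⟩⟩ =>
        f2 (GLG.mkA F tl2 hd2 rk2 (FreeAlgebra.ι F ⟨e, ⟨j, h.1, hl2 e ▸ h.2⟩⟩))
  let ψ := FreeAlgebra.lift F gen
  have H1 : ∀ e j h h', ψ (FreeAlgebra.ι F ⟨Sum.inl e, ⟨j, h⟩⟩) =
      f1 (GLG.mkA F tl1 hd1 rk1 (FreeAlgebra.ι F ⟨e, ⟨j, h'⟩⟩)) := by
    intro e j h h'
    exact FreeAlgebra.lift_ι_apply _ _
  have H2 : ∀ e j h h', ψ (FreeAlgebra.ι F ⟨Sum.inr e, ⟨j, h⟩⟩) =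
      f2 (GLG.mkA F tl2 hd2 rk2 (FreeAlgebra.ι F ⟨e, ⟨j, h'⟩⟩)) := by
    intro e j h h'
    exact FreeAlgebra.lift_ι_apply _ _
  have hrel : ∀ ⦃x y⦄, GLG.rel F (GLG.bqTl tl1 tl2 s1 s2) (GLG.bqHd hd1 hd2 s1 s2)
      (GLG.bqRk rk1 rk2 s1 s2) x y → ψ x = ψ y := by
    rintro x y ⟨e1, es1, e2, es2, j, hp1, hp2, ht, hd, hj, hj', rfl, rfl⟩
    rcases e1 with e1 | e1 <;> rcases e2 with e2 | e2
    · exact GLG.rel_lift tl1 hd1 rk1 _ _ _ Sum.inl (GLG.bqEmb1 s1 s2) (GLG.bqEmb1_inj s1 s2)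
        (GLG.bqRk_emb1 hs1) (fun _ => rfl) (fun _ => rfl)
        (by
          rintro e (e' | e') h
          · exact ⟨e', rfl⟩
          · exact absurd (GLG.bqEmb_ne s1 s2 _ _ h).2 (ht2 _))
        ψ f1 H1 e1 e2 es1 es2 j hp1 hp2 ht hd hj hj'
    · exact absurd (GLG.bqEmb_ne s1 s2 _ _ ht).2 (ht2 _)
    · exact absurd (GLG.bqEmb_ne s1 s2 _ _ ht.symm).2 (ht2 _)
    · exact GLG.rel_lift tl2 hd2 rk2 _ _ _ Sum.inr (GLG.bqEmb2 s1 s2) (GLG.bqEmb2_inj s1 s2)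
        (GLG.bqRk_emb2 hs2) (fun _ => rfl) (fun _ => rfl)
        (by
          rintro e (e' | e') h
          · exact absurd (GLG.bqEmb_ne s1 s2 _ _ h.symm).1 (ht1 _)
          · exact ⟨e', rfl⟩)
        ψ f2 H2 e1 e2 es1 es2 j hp1 hp2 ht hd hj hj'
  let g := RingQuot.liftAlgHom F ⟨ψ, hrel⟩
  have hg : ∀ x, g (GLG.mkA F _ _ _ x) = ψ x := fun x =>
    RingQuot.liftAlgHom_mkAlgHom_apply (S := F) ψ hrel x
  refine ⟨g, ⟨?_, ?_⟩, ?_⟩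
  · apply RingQuot.ringQuot_ext'
    apply FreeAlgebra.hom_ext
    funext s
    change g (φ1 (GLG.mkA F tl1 hd1 rk1 _)) = f1 (GLG.mkA F tl1 hd1 rk1 _)
    rw [hφ1, hg, FreeAlgebra.lift_ι_apply]
    exact H1 _ _ _ _
  · apply RingQuot.ringQuot_ext'
    apply FreeAlgebra.hom_ext
    funext s
    change g (φ2 (GLG.mkA F tl2 hd2 rk2 _)) = f2 (GLG.mkA F tl2 hd2 rk2 _)
    rw [hφ2, hg, FreeAlgebra.lift_ι_apply]
    exact H2 _ _ _ _
  · rintro g' ⟨h1, h2⟩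
    apply RingQuot.ringQuot_ext'
    apply FreeAlgebra.hom_ext
    funext s
    change g' (GLG.mkA F _ _ _ (FreeAlgebra.ι F s)) = g (GLG.mkA F _ _ _ (FreeAlgebra.ι F s))
    rw [hg]
    rcases s with ⟨e | e, j, h⟩
    · have h' : 1 ≤ j ∧ j ≤ GLG.len tl1 hd1 rk1 e := ⟨h.1, hl1 e ▸ h.2⟩
      rw [H1 e j h h', ← h1, AlgHom.comp_apply, hφ1, FreeAlgebra.lift_ι_apply]
      rfl
    · have h' : 1 ≤ j ∧ j ≤ GLG.len tl2 hd2 rk2 e := ⟨h.1, hl2 e ▸ h.2⟩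
      rw [H2 e j h h', ← h2, AlgHom.comp_apply, hφ2, FreeAlgebra.lift_ι_apply]
      rfl
end

section
/- Let Γ be a finite generalized layered graph, let e ∈ E have l(e) > 1 with t(e) = u, h(e) = v, and let Γ^w be obtained from Γ by placing a new vertex w on e (for a fixed integer i with 0 < i < l(e)). Let Γ^w_+ be the full subgraph of Γ^w induced on {x : x ≥ w} and Γ^w_- the full subgraph induced on {x : w ≥ x} (with the restricted rank functions). Then M(Γ^w)(z) = M(Γ)(z) + M_∘(Γ^w_+)(z) · M^∘(Γ^w_-)(z). -/
open scoped BigOperators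

namespace GLG

variable {V E : Type}

/-- Vertex set of `Γ^w`: `V` together with the new vertex `w = none`. -/
abbrev InsV (V : Type) : Type := Option V

/-- Edge set of `Γ^w`: the edges of `Γ` other than `e₀`, together with the two new edges
`e₁ = Sum.inr false` (from `t(e₀)` to `w`) and `e₂ = Sum.inr true` (from `w` to `h(e₀)`). -/
abbrev InsE (E : Type) (e0 : E) : Type := {f : E // f ≠ e0} ⊕ Bool

/-- Tail map of `Γ^w`. -/
def insTl (tl : E → V) (e0 : E) : InsE E e0 → InsV V :=
  Sum.elim (fun f => some (tl f.1)) (fun b => if b then none else some (tl e0))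

/-- Head map of `Γ^w`. -/
def insHd (hd : E → V) (e0 : E) : InsE E e0 → InsV V :=
  Sum.elim (fun f => some (hd f.1)) (fun b => if b then some (hd e0) else none)

/-- Rank function of `Γ^w`: `|w| = |h(e₀)| + i`. -/
def insRk (hd : E → V) (rk : V → ℕ) (e0 : E) (i : ℕ) : InsV V → ℕ
  | none => rk (hd e0) + i
  | some v => rk v

/-- `a_k(e)` for `1 ≤ k ≤ l(e)`, with the conventions `a_0(e) = 1` (and junk value `0`
out of range). -/
noncomputable def genOrOne (F : Type) [Field F] (tl hd : E → V) (rk : V → ℕ)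
    (ed : E) (k : ℕ) : FreeAlgebra F (ESharp tl hd rk) :=
  if h : 1 ≤ k ∧ k ≤ len tl hd rk ed then FreeAlgebra.ι F ⟨ed, ⟨k, h⟩⟩
  else if k = 0 then 1 else 0

open Classical in
/-- The map on generators inducing `ι : A(Γ) → A(Γ^w)`:
`a_j(f) ↦ a_j(f)` for `f ≠ e₀`, and
`a_j(e₀) ↦ Σ_{max(0, i+j-l(e₁)) ≤ k ≤ min(i,j)} a_{j-k}(e₁) a_k(e₂)`. -/
noncomputable def insGen (F : Type) [Field F] (tl hd : E → V) (rk : V → ℕ) (e0 : E) (i : ℕ) :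
    ESharp tl hd rk →
      FreeAlgebra F (ESharp (insTl tl e0) (insHd hd e0) (insRk hd rk e0 i)) :=
  fun s =>
    if hf : s.1 = e0 then
      ∑ k ∈ Finset.Icc (i + s.2.1 - (len tl hd rk e0 - i)) (min i s.2.1),
        genOrOne F (insTl tl e0) (insHd hd e0) (insRk hd rk e0 i) (Sum.inr false) (s.2.1 - k) *
          genOrOne F (insTl tl e0) (insHd hd e0) (insRk hd rk e0 i) (Sum.inr true) k
    else
      FreeAlgebra.ι F ⟨Sum.inl ⟨s.1, hf⟩, ⟨s.2.1, s.2.2.1, s.2.2.2⟩⟩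

end GLG

namespace GLG

variable {V E : Type}

/-- Vertex set of `Γ^w₊`, the full subgraph of `Γ^w` on `{x : x ≥ w}` (`w = none`). -/
abbrev InsPlusV (tl hd : E → V) (e0 : E) (i : ℕ) : Type :=
  {x : InsV V // GE (insTl tl e0) (insHd hd e0) x none}

/-- Edge set of `Γ^w₊`. -/
abbrev InsPlusE (tl hd : E → V) (e0 : E) (i : ℕ) : Type :=
  {f : InsE E e0 // GE (insTl tl e0) (insHd hd e0) (insTl tl e0 f) none ∧
    GE (insTl tl e0) (insHd hd e0) (insHd hd e0 f) none}

def insPlusTl (tl hd : E → V) (e0 : E) (i : ℕ) :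
    InsPlusE tl hd e0 i → InsPlusV tl hd e0 i :=
  fun f => ⟨insTl tl e0 f.1, f.2.1⟩

def insPlusHd (tl hd : E → V) (e0 : E) (i : ℕ) :
    InsPlusE tl hd e0 i → InsPlusV tl hd e0 i :=
  fun f => ⟨insHd hd e0 f.1, f.2.2⟩

def insPlusRk (tl hd : E → V) (rk : V → ℕ) (e0 : E) (i : ℕ) :
    InsPlusV tl hd e0 i → ℕ :=
  fun x => insRk hd rk e0 i x.1

/-- The new vertex `w`, the unique minimal vertex of `Γ^w₊`. -/
def insPlusW (tl hd : E → V) (e0 : E) (i : ℕ) : InsPlusV tl hd e0 i :=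
  ⟨none, Or.inl rfl⟩

/-- Vertex set of `Γ^w₋`, the full subgraph of `Γ^w` on `{x : w ≥ x}` (`w = none`). -/
abbrev InsMinusV (tl hd : E → V) (e0 : E) (i : ℕ) : Type :=
  {x : InsV V // GE (insTl tl e0) (insHd hd e0) (none : InsV V) x}

/-- Edge set of `Γ^w₋`. -/
abbrev InsMinusE (tl hd : E → V) (e0 : E) (i : ℕ) : Type :=
  {f : InsE E e0 // GE (insTl tl e0) (insHd hd e0) (none : InsV V) (insTl tl e0 f) ∧
    GE (insTl tl e0) (insHd hd e0) (none : InsV V) (insHd hd e0 f)}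

def insMinusTl (tl hd : E → V) (e0 : E) (i : ℕ) :
    InsMinusE tl hd e0 i → InsMinusV tl hd e0 i :=
  fun f => ⟨insTl tl e0 f.1, f.2.1⟩

def insMinusHd (tl hd : E → V) (e0 : E) (i : ℕ) :
    InsMinusE tl hd e0 i → InsMinusV tl hd e0 i :=
  fun f => ⟨insHd hd e0 f.1, f.2.2⟩

def insMinusRk (tl hd : E → V) (rk : V → ℕ) (e0 : E) (i : ℕ) :
    InsMinusV tl hd e0 i → ℕ :=
  fun x => insRk hd rk e0 i x.1

/-- The new vertex `w`, the unique maximal vertex of `Γ^w₋`. -/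
def insMinusW (tl hd : E → V) (e0 : E) (i : ℕ) : InsMinusV tl hd e0 i :=
  ⟨none, Or.inl rfl⟩

end GLG

namespace GLG

theorem reaches_iff {V E : Type} (tl hd : E → V) (v w : V) :
    Reaches tl hd v w ↔ Relation.TransGen (fun a b => ∃ e, tl e = a ∧ hd e = b) v w := by
  constructor
  · rintro ⟨e, es, hp, rfl, rfl⟩
    induction es generalizing e with
    | nil => exact Relation.TransGen.single ⟨e, rfl, rfl⟩
    | cons f es ih =>
      have hp' : hd e = tl f ∧ List.Chain (fun a b => hd a = tl b) f es := by
        simpa [IsPathC, List.Chain] using hp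
      have := ih f hp'.2
      have h2 : pathDst hd e (f :: es) = pathDst hd f es := by
        simp [pathDst]
      rw [h2]
      exact Relation.TransGen.head ⟨e, rfl, hp'.1⟩ this
  · intro h
    induction h using Relation.TransGen.head_induction_on with
    | single h =>
      obtain ⟨e, h1, h2⟩ := h
      exact ⟨e, [], by simp [IsPathC, List.Chain], h1, by simpa [pathDst] using h2⟩
    | head h _ ih =>
      obtain ⟨e, h1, h2⟩ := h
      obtain ⟨f, es, hp, h3, h4⟩ := ih
      refine ⟨e, f :: es, ?_, h1, ?_⟩
      · have : hd e = tl f ∧ List.Chain (fun a b => hd a = tl b) f es := ⟨h2.trans h3.symm, hp⟩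
        simpa [IsPathC, List.Chain] using this
      · rw [← h4]; simp [pathDst]

/-- chains from v to w -/
def CS {V : Type} (R : V → V → Prop) (v w : V) : Set (List V) :=
  {c : List V | c.Chain' R ∧ c.head? = some v ∧ c.getLast? = some w}

noncomputable def mu {V : Type} (R : V → V → Prop) (v w : V) : ℤ :=
  ∑ᶠ c ∈ CS R v w, (-1 : ℤ) ^ (c.length + 1)

open Classical in
theorem CS_rec {V : Type} (R : V → V → Prop) (v w : V) :
    CS R v w = (if v = w then {[v]} else ∅) ∪ ⋃ x ∈ {x | R v x}, (List.cons v) '' CS R x w := by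
  ext c
  match c with
  | [] => simp [CS]
  | [a] =>
    simp only [CS, Set.mem_setOf_eq, Set.mem_union, Set.mem_iUnion, Set.mem_image]
    by_cases h : v = w
    · subst h; simp [List.Chain']
    · simp [List.Chain', h]; intro h1 h2; exact h (h1.symm.trans h2)
  | a :: b :: l =>
    simp only [CS, Set.mem_setOf_eq, Set.mem_union, Set.mem_iUnion, Set.mem_image]
    have : (a :: b :: l) ∉ (if v = w then {[v]} else ∅ : Set (List V)) := by
      split_ifs <;> simp
    simp only [this, false_or]
    simp only [List.Chain', List.isChain_cons_cons, List.head?_cons, Option.some.injEq,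
      List.getLast?_cons_cons, List.cons.injEq]
    constructor
    · rintro ⟨⟨h1, h2⟩, rfl, h3⟩
      exact ⟨b, h1, b :: l, ⟨h2, rfl, h3⟩, rfl, rfl⟩
    · rintro ⟨x, h1, c, ⟨h2, h3, h4⟩, rfl, rfl⟩
      simp at h3; subst h3
      exact ⟨⟨h1, h2⟩, rfl, h4⟩

theorem CS_fin {V : Type} [Finite V] (R : V → V → Prop) (rk : V → ℕ)
    (hR : ∀ a b, R a b → rk b < rk a) (w : V) : ∀ (n : ℕ) (v : V), rk v < n → (CS R v w).Finite := by
  intro n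
  induction n with
  | zero => intro v h; omega
  | succ n ih =>
    intro v h
    rw [CS_rec]
    refine Set.Finite.union (by split_ifs <;> simp) ?_
    refine Set.Finite.biUnion (Set.toFinite _) ?_
    intro x hx
    exact (ih x (by have := hR _ _ hx; omega)).image _

open Classical in
theorem mu_rec {V : Type} [Fintype V] (R : V → V → Prop) (rk : V → ℕ)
    (hR : ∀ a b, R a b → rk b < rk a) (v w : V) :
    mu R v w = (if v = w then 1 else 0) - ∑ x : V, if R v x then mu R x w else 0 := by
  have fin : ∀ v, (CS R v w).Finite := fun v => CS_fin R rk hR w _ v (Nat.lt_succ_self _)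
  unfold mu
  rw [CS_rec R v w, finsum_mem_union]
  · rw [finsum_mem_biUnion]
    · have e1 : ∀ x, ∑ᶠ c ∈ List.cons v '' CS R x w, (-1 : ℤ) ^ (c.length + 1)
          = - ∑ᶠ c ∈ CS R x w, (-1 : ℤ) ^ (c.length + 1) := by
        intro x
        rw [finsum_mem_image (fun a _ b _ h => by simpa using h), ← finsum_mem_neg_distrib _ (fin x)]
        refine finsum_mem_congr rfl fun c _ => ?_
        simp [pow_succ]
      simp only [e1]
      rw [sub_eq_add_neg, ← Finset.sum_neg_distrib]
      congr 1
      · split_ifs <;> simp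
      · rw [finsum_mem_eq_toFinset_sum, ← Finset.sum_filter_add_sum_filter_not Finset.univ (R v)]
        rw [Finset.sum_congr (g := fun x => -(if R v x then ∑ᶠ c ∈ CS R x w, (-1 : ℤ) ^ (c.length + 1) else 0)) rfl]
        · refine (left_eq_add.mpr ?_).trans (congrArg₂ (· + ·) ?_ rfl)
          rotate_left
          · apply Finset.sum_congr _ fun _ _ => rfl
            ext; simp
          · apply Finset.sum_eq_zero; intro x hx; simp at hx; simp [hx]
        · intro x hx; simp at hx; simp [hx]
    · intro x _ y _ hxy
      rw [Function.onFun, Set.disjoint_left]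
      rintro _ ⟨c, hc, rfl⟩ ⟨d, hd, h⟩
      simp at h; subst h
      apply hxy
      have := hc.2.1.symm.trans hd.2.1
      simpa using this
    · exact Set.toFinite _
    · intro x _; exact (fin x).image _
  · rw [Set.disjoint_left]
    intro c hc hc'
    simp only [Set.mem_iUnion, Set.mem_image] at hc'
    obtain ⟨x, _, d, hd, rfl⟩ := hc'
    have : d ≠ [] := by rintro rfl; simp [CS] at hd
    split_ifs at hc <;> simp at hc
    exact this hc
  · split_ifs <;> simp
  · exact Set.Finite.biUnion (Set.toFinite _) fun x _ => (fin x).image _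

theorem mu_zero {V : Type} [Fintype V] (R : V → V → Prop) (rk : V → ℕ)
    (hR : ∀ a b, R a b → rk b < rk a) (ht : ∀ a b c, R a b → R b c → R a c) (w : V) :
    ∀ (n : ℕ) (v : V), rk v < n → ¬ (v = w ∨ R v w) → mu R v w = 0 := by
  classical
  intro n
  induction n with
  | zero => intro v h; omega
  | succ n ih =>
    intro v h hn
    push Not at hn
    rw [mu_rec R rk hR, if_neg hn.1, Finset.sum_eq_zero, sub_zero]
    intro x _
    split_ifs with hx
    · refine ih x (by have := hR _ _ hx; omega) ?_
      rintro (rfl | h2)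
      · exact hn.2 hx
      · exact hn.2 (ht _ _ _ hx h2)
    · rfl

theorem mu_self {V : Type} [Fintype V] (R : V → V → Prop) (rk : V → ℕ)
    (hR : ∀ a b, R a b → rk b < rk a) (ht : ∀ a b c, R a b → R b c → R a c) (w : V) :
    mu R w w = 1 := by
  classical
  rw [mu_rec R rk hR, if_pos rfl, Finset.sum_eq_zero, sub_zero]
  intro x _
  split_ifs with hx
  · refine mu_zero R rk hR ht w _ x (Nat.lt_succ_self _) ?_
    have := hR _ _ hx
    rintro (rfl | h2)
    · omega
    · have := hR _ _ h2; omega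
  · rfl

theorem mu_sub {V : Type} [Fintype V] (R : V → V → Prop) (rk : V → ℕ)
    (hR : ∀ a b, R a b → rk b < rk a) (p : V → Prop) (S : {x // p x} → {x // p x} → Prop)
    (hS : ∀ a b, S a b ↔ R a.1 b.1) (y : {x // p x})
    (h0 : ∀ x z, p x → R x z → ¬ p z → mu R z y.1 = 0) :
    ∀ (n : ℕ) (x : {x // p x}), rk x.1 < n → mu S x y = mu R x.1 y.1 := by
  classical
  intro n
  induction n with
  | zero => intro v h; omega
  | succ n ih =>
    intro v h
    rw [mu_rec R rk hR, mu_rec S (fun x => rk x.1) (fun a b h => hR _ _ ((hS a b).1 h))]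
    congr 1
    · simp [Subtype.ext_iff]
    · have e : ∀ x : {x // p x}, (if S v x then mu S x y else 0)
          = (fun z => if R v.1 z then mu R z y.1 else 0) x.1 := by
        intro x
        simp only [hS]
        split_ifs with hx
        · exact ih x (by have := hR _ _ hx; omega)
        · rfl
      rw [Finset.sum_congr rfl fun x _ => e x]
      rw [← Finset.sum_filter_add_sum_filter_not Finset.univ p]
      refine (left_eq_add.mpr ?_).trans (congrArg₂ (· + ·) ?_ rfl)
      rotate_left
      · have := Finset.sum_subtype_eq_sum_filter (s := Finset.univ) (p := p)
          (fun z => if R v.1 z then mu R z y.1 else 0)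
        rw [← this]
        apply Finset.sum_congr _ fun _ _ => rfl
        ext; simp
      · apply Finset.sum_eq_zero
        intro x hx
        simp at hx
        split_ifs with h1
        · exact h0 _ _ v.2 h1 hx
        · rfl

theorem mu_option {V : Type} [Fintype V] (R : V → V → Prop) (S : Option V → Option V → Prop)
    (rk : Option V → ℕ)
    (hR : ∀ a b, S a b → rk b < rk a) (ht : ∀ a b c, S a b → S b c → S a c)
    (hS : ∀ a b, S (some a) (some b) ↔ R a b) (y : V) :
    ∀ (n : ℕ) (x : V), rk (some x) < n →
      mu S (some x) (some y) = mu R x y + mu S (some x) none * mu S none (some y) := by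
  classical
  intro n
  induction n with
  | zero => intro v h; omega
  | succ n ih =>
    intro v h
    rw [mu_rec S rk hR (some v) (some y), mu_rec S rk hR (some v) none,
      mu_rec R (fun x => rk (some x)) (fun a b h => hR _ _ ((hS a b).2 h))]
    rw [Fintype.sum_option, Fintype.sum_option, mu_self S rk hR ht none]
    have e : ∀ x, (if S (some v) (some x) then mu S (some x) (some y) else 0)
        = (if R v x then mu R x y else 0) +
          (if S (some v) (some x) then mu S (some x) none else 0) * mu S none (some y) := by
      intro x
      by_cases hx : R v x
      · have hx' := (hS v x).2 hx
        simp only [hx, hx', if_true]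
        exact ih x (by have := hR _ _ hx'; omega)
      · have hx' : ¬ S (some v) (some x) := fun h => hx ((hS v x).1 h)
        simp [hx, hx']
    rw [Finset.sum_congr rfl fun x _ => e x, Finset.sum_add_distrib, ← Finset.sum_mul]
    by_cases h1 : S (some v) none <;> simp [h1] <;> ring

theorem mob_eq {V E : Type} (tl hd : E → V) (v w : V) :
    mob tl hd v w = mu (Reaches tl hd) v w := rfl

theorem reaches_rk {V E : Type} (tl hd : E → V) (rk : V → ℕ) (h : IsRank tl hd rk) (a b : V)
    (hab : Reaches tl hd a b) : rk b < rk a := by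
  rw [reaches_iff] at hab
  induction hab with
  | single h1 => obtain ⟨e, rfl, rfl⟩ := h1; exact h e
  | tail _ h1 ih => obtain ⟨e, rfl, rfl⟩ := h1; exact (h e).trans ih

theorem reaches_trans {V E : Type} (tl hd : E → V) (a b c : V)
    (h1 : Reaches tl hd a b) (h2 : Reaches tl hd b c) : Reaches tl hd a c := by
  rw [reaches_iff] at *
  exact h1.trans h2

theorem ins_rank {V E : Type} (tl hd : E → V) (rk : V → ℕ) (hrank : IsRank tl hd rk)
    (e0 : E) (i : ℕ) (hi1 : 0 < i) (hi2 : i < len tl hd rk e0) :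
    IsRank (insTl tl e0) (insHd hd e0) (insRk hd rk e0 i) := by
  unfold len at hi2
  rintro (f | b)
  · exact hrank f.1
  · cases b <;> simp [insTl, insHd, insRk] <;> omega

theorem ins_reaches {V E : Type} (tl hd : E → V) (e0 : E) (x y : V) :
    Reaches (insTl tl e0) (insHd hd e0) (some x) (some y) ↔ Reaches tl hd x y := by
  classical
  constructor
  · intro h
    rw [reaches_iff] at h
    have key : ∀ b, Relation.TransGen (fun a b => ∃ e, insTl tl e0 e = a ∧ insHd hd e0 e = b)
        (some x) b → (∀ y, b = some y → Reaches tl hd x y) ∧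
          (b = none → x = tl e0 ∨ Reaches tl hd x (tl e0)) := by
      intro b hb
      induction hb with
      | single h =>
        obtain ⟨(f | b), h1, rfl⟩ := h
        · simp [insTl, insHd] at *
          rw [reaches_iff]; exact .single ⟨f, h1, rfl⟩
        · cases b <;> simp [insTl, insHd] at *
          exact .inl h1.symm
      | tail _ h ih =>
        obtain ⟨(f | b), rfl, rfl⟩ := h
        · simp only [insTl, insHd, Sum.elim_inl, Option.some.injEq, reduceCtorEq,
            false_imp_iff, and_true, forall_eq'] at *
          rw [reaches_iff] at *
          exact ih.tail ⟨f, rfl, rfl⟩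
        · cases b <;> simp [insTl, insHd] at *
          · exact .inr ih
          · have e : Reaches tl hd (tl e0) (hd e0) := by
              rw [reaches_iff]; exact .single ⟨e0, rfl, rfl⟩
            rcases ih with rfl | ih
            · exact e
            · exact reaches_trans _ _ _ _ _ ih e
    exact (key _ h).1 y rfl
  · intro h
    rw [reaches_iff] at *
    have st : ∀ f : E, Relation.TransGen
        (fun a b => ∃ e, insTl tl e0 e = a ∧ insHd hd e0 e = b) (some (tl f)) (some (hd f)) := by
      intro f
      by_cases hf : f = e0
      · subst hf
        exact .tail (.single (b := none) ⟨.inr false, by simp [insTl], by simp [insHd]⟩)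
          ⟨.inr true, by simp [insTl], by simp [insHd]⟩
      · exact .single ⟨.inl ⟨f, hf⟩, rfl, rfl⟩
    induction h with
    | single h => obtain ⟨f, rfl, rfl⟩ := h; exact st f
    | tail _ h ih => obtain ⟨f, rfl, rfl⟩ := h; exact ih.trans (st f)

theorem plus_reaches {V E : Type} (tl hd : E → V) (e0 : E) (i : ℕ) (a b : InsPlusV tl hd e0 i) :
    Reaches (insPlusTl tl hd e0 i) (insPlusHd tl hd e0 i) a b ↔
      Reaches (insTl tl e0) (insHd hd e0) a.1 b.1 := by
  constructor
  · intro h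
    rw [reaches_iff] at *
    refine Relation.TransGen.lift Subtype.val ?_ _ _ h
    rintro _ _ ⟨e, rfl, rfl⟩
    exact ⟨e.1, rfl, rfl⟩
  · intro h
    obtain ⟨a, ha⟩ := a
    obtain ⟨b, hb⟩ := b
    simp only at h
    rw [reaches_iff] at *
    induction h using Relation.TransGen.head_induction_on with
    | single h => obtain ⟨e, rfl, rfl⟩ := h; exact .single ⟨⟨e, ha, hb⟩, rfl, rfl⟩
    | head h h2 ih =>
      obtain ⟨e, rfl, rfl⟩ := h
      have hc : GE (insTl tl e0) (insHd hd e0) (insHd hd e0 e) none := by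
        rw [← reaches_iff] at h2
        rcases hb with rfl | hb
        · exact .inr h2
        · exact .inr (reaches_trans _ _ _ _ _ h2 hb)
      exact .head ⟨⟨e, ha, hc⟩, rfl, rfl⟩ (ih hc)

theorem minus_reaches {V E : Type} (tl hd : E → V) (e0 : E) (i : ℕ) (a b : InsMinusV tl hd e0 i) :
    Reaches (insMinusTl tl hd e0 i) (insMinusHd tl hd e0 i) a b ↔
      Reaches (insTl tl e0) (insHd hd e0) a.1 b.1 := by
  constructor
  · intro h
    rw [reaches_iff] at *
    refine Relation.TransGen.lift Subtype.val ?_ _ _ h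
    rintro _ _ ⟨e, rfl, rfl⟩
    exact ⟨e.1, rfl, rfl⟩
  · intro h
    obtain ⟨a, ha⟩ := a
    obtain ⟨b, hb⟩ := b
    simp only at h
    rw [reaches_iff] at *
    induction h with
    | single h => obtain ⟨e, rfl, rfl⟩ := h; exact .single ⟨⟨e, ha, hb⟩, rfl, rfl⟩
    | tail h2 h ih =>
      obtain ⟨e, rfl, rfl⟩ := h
      have hc : GE (insTl tl e0) (insHd hd e0) none (insTl tl e0 e) := by
        rw [← reaches_iff] at h2
        rcases ha with rfl | ha
        · exact .inr h2
        · exact .inr (reaches_trans _ _ _ _ _ ha h2)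
      exact .tail (ih hc) ⟨⟨e, hc, hb⟩, rfl, rfl⟩

theorem MGamma_eq {V E : Type} [Fintype V] (tl hd : E → V) (rk : V → ℕ) (hrank : IsRank tl hd rk) :
    MGamma tl hd rk = ∑ a : V, ∑ b : V,
      mob tl hd a b • (PowerSeries.X : PowerSeries ℤ) ^ (rk a - rk b) := by
  classical
  unfold MGamma
  rw [← Fintype.sum_prod_type', ← finsum_eq_sum_of_fintype]
  refine finsum_congr fun p => ?_
  by_cases h : GE tl hd p.1 p.2
  · exact finsum_eq_if.trans (if_pos h)
  · have : mob tl hd p.1 p.2 = 0 :=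
      mu_zero _ rk (reaches_rk tl hd rk hrank) (reaches_trans tl hd) _ _ _ (Nat.lt_succ_self _) h
    simp [this]

end GLG

/-- **Proposition 5.1.** Let `Γ` be a finite generalized layered graph, let
`e₀` be an edge of length `> 1`, and let `Γ^w` be obtained from `Γ` by placing a new vertex
`w` on `e₀` (with `|w| = |h(e₀)| + i`, `0 < i < l(e₀)`).  Let `Γ^w₊` and `Γ^w₋` be the full
subgraphs of `Γ^w` induced on `{x : x ≥ w}` and `{x : w ≥ x}`.  Then
`M(Γ^w)(z) = M(Γ)(z) + M_∘(Γ^w₊)(z) · M^∘(Γ^w₋)(z)`. -/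
theorem MGamma_insert_vertex {V E : Type} [Fintype V] [Fintype E]
    (tl hd : E → V) (rk : V → ℕ) (hrank : GLG.IsRank tl hd rk)
    (e0 : E) (hlen : 1 < GLG.len tl hd rk e0)
    (i : ℕ) (hi1 : 0 < i) (hi2 : i < GLG.len tl hd rk e0) :
    GLG.MGamma (GLG.insTl tl e0) (GLG.insHd hd e0) (GLG.insRk hd rk e0 i) =
      GLG.MGamma tl hd rk +
        GLG.MLow (GLG.insPlusTl tl hd e0 i) (GLG.insPlusHd tl hd e0 i)
            (GLG.insPlusRk tl hd rk e0 i) (GLG.insPlusW tl hd e0 i) *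
          GLG.MUp (GLG.insMinusTl tl hd e0 i) (GLG.insMinusHd tl hd e0 i)
            (GLG.insMinusRk tl hd rk e0 i) (GLG.insMinusW tl hd e0 i) := by
  classical
  have hrw := GLG.ins_rank tl hd rk hrank e0 i hi1 hi2
  have hR := GLG.reaches_rk _ _ _ hrw
  have hT := GLG.reaches_trans (GLG.insTl tl e0) (GLG.insHd hd e0)
  have hz : ∀ a b, ¬ GLG.GE (GLG.insTl tl e0) (GLG.insHd hd e0) a b →
      GLG.mob (GLG.insTl tl e0) (GLG.insHd hd e0) a b = 0 := fun a b h =>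
    GLG.mu_zero _ _ hR hT _ _ _ (Nat.lt_succ_self _) h
  have hlow : GLG.MLow (GLG.insPlusTl tl hd e0 i) (GLG.insPlusHd tl hd e0 i)
      (GLG.insPlusRk tl hd rk e0 i) (GLG.insPlusW tl hd e0 i) =
      ∑ a : Option V, GLG.mob (GLG.insTl tl e0) (GLG.insHd hd e0) a none •
        (PowerSeries.X : PowerSeries ℤ) ^
          (GLG.insRk hd rk e0 i a - GLG.insRk hd rk e0 i none) := by
    unfold GLG.MLow
    rw [← finsum_eq_sum_of_fintype]
    have h1 : ∀ x : GLG.InsPlusV tl hd e0 i,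
        GLG.mob (GLG.insPlusTl tl hd e0 i) (GLG.insPlusHd tl hd e0 i) x (GLG.insPlusW tl hd e0 i)
        = GLG.mob (GLG.insTl tl e0) (GLG.insHd hd e0) x.1 none := fun x =>
      GLG.mu_sub _ _ hR _ _ (GLG.plus_reaches tl hd e0 i) (GLG.insPlusW tl hd e0 i)
        (fun _ z _ _ hn => hz z none hn) _ x (Nat.lt_succ_self _)
    simp only [h1]
    refine (finsum_subtype_eq_finsum_cond (p := _) (f :=
      (fun a : Option V => GLG.mob (GLG.insTl tl e0) (GLG.insHd hd e0) a none •
        (PowerSeries.X : PowerSeries ℤ) ^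
          (GLG.insRk hd rk e0 i a - GLG.insRk hd rk e0 i none)))).trans ?_
    refine finsum_congr fun a => ?_
    by_cases h : GLG.GE (GLG.insTl tl e0) (GLG.insHd hd e0) a none
    · exact finsum_eq_if.trans (if_pos h)
    · simp [hz _ _ h]
  have hup : GLG.MUp (GLG.insMinusTl tl hd e0 i) (GLG.insMinusHd tl hd e0 i)
      (GLG.insMinusRk tl hd rk e0 i) (GLG.insMinusW tl hd e0 i) =
      ∑ a : Option V, GLG.mob (GLG.insTl tl e0) (GLG.insHd hd e0) none a •
        (PowerSeries.X : PowerSeries ℤ) ^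
          (GLG.insRk hd rk e0 i none - GLG.insRk hd rk e0 i a) := by
    unfold GLG.MUp
    rw [← finsum_eq_sum_of_fintype]
    have h1 : ∀ x : GLG.InsMinusV tl hd e0 i,
        GLG.mob (GLG.insMinusTl tl hd e0 i) (GLG.insMinusHd tl hd e0 i)
          (GLG.insMinusW tl hd e0 i) x
        = GLG.mob (GLG.insTl tl e0) (GLG.insHd hd e0) none x.1 := fun x =>
      GLG.mu_sub _ _ hR _ _ (GLG.minus_reaches tl hd e0 i) x
        (fun y z hy hyz hn => absurd (by
          rcases hy with rfl | hy
          · exact .inr hyz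
          · exact .inr (hT _ _ _ hy hyz)) hn) _ (GLG.insMinusW tl hd e0 i) (Nat.lt_succ_self _)
    simp only [h1]
    refine (finsum_subtype_eq_finsum_cond (p := _) (f :=
      (fun a : Option V => GLG.mob (GLG.insTl tl e0) (GLG.insHd hd e0) none a •
        (PowerSeries.X : PowerSeries ℤ) ^
          (GLG.insRk hd rk e0 i none - GLG.insRk hd rk e0 i a)))).trans ?_
    refine finsum_congr fun a => ?_
    by_cases h : GLG.GE (GLG.insTl tl e0) (GLG.insHd hd e0) none a
    · exact finsum_eq_if.trans (if_pos h)
    · simp [hz _ _ h]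
  have hself : GLG.mob (GLG.insTl tl e0) (GLG.insHd hd e0) none none = 1 :=
    GLG.mu_self _ _ hR hT _
  have hkey : ∀ x y, GLG.mob (GLG.insTl tl e0) (GLG.insHd hd e0) (some x) (some y) =
      GLG.mob tl hd x y + GLG.mob (GLG.insTl tl e0) (GLG.insHd hd e0) (some x) none *
        GLG.mob (GLG.insTl tl e0) (GLG.insHd hd e0) none (some y) := fun x y =>
    GLG.mu_option _ _ _ hR hT (GLG.ins_reaches tl hd e0) y _ x (Nat.lt_succ_self _)
  have hprod : ∀ a b : Option V,
      (GLG.mob (GLG.insTl tl e0) (GLG.insHd hd e0) a none •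
        (PowerSeries.X : PowerSeries ℤ) ^
          (GLG.insRk hd rk e0 i a - GLG.insRk hd rk e0 i none)) *
      (GLG.mob (GLG.insTl tl e0) (GLG.insHd hd e0) none b •
        (PowerSeries.X : PowerSeries ℤ) ^
          (GLG.insRk hd rk e0 i none - GLG.insRk hd rk e0 i b)) =
      (GLG.mob (GLG.insTl tl e0) (GLG.insHd hd e0) a none *
        GLG.mob (GLG.insTl tl e0) (GLG.insHd hd e0) none b) •
        (PowerSeries.X : PowerSeries ℤ) ^
          (GLG.insRk hd rk e0 i a - GLG.insRk hd rk e0 i b) := by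
    intro a b
    by_cases h1 : GLG.GE (GLG.insTl tl e0) (GLG.insHd hd e0) a none
    · by_cases h2 : GLG.GE (GLG.insTl tl e0) (GLG.insHd hd e0) none b
      · have r1 : GLG.insRk hd rk e0 i none ≤ GLG.insRk hd rk e0 i a := by
          rcases h1 with rfl | h1
          · exact le_rfl
          · exact (hR _ _ h1).le
        have r2 : GLG.insRk hd rk e0 i b ≤ GLG.insRk hd rk e0 i none := by
          rcases h2 with rfl | h2
          · exact le_rfl
          · exact (hR _ _ h2).le
        rw [smul_mul_smul_comm, ← pow_add]
        congr 2
        omega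
      · simp [hz _ _ h2]
    · simp [hz _ _ h1]
  rw [hlow, hup, Finset.sum_mul_sum, GLG.MGamma_eq _ _ _ hrw, GLG.MGamma_eq _ _ _ hrank]
  simp only [hprod]
  simp only [Fintype.sum_option, hself, hkey, add_smul, Finset.sum_add_distrib, one_mul, mul_one,
    GLG.insRk]
  abel
end

section
/- Let Γ be a finite generalized layered graph, let v,w be vertices with |v| > |w| such that there is a directed path in Γ from v to w, and let Γ^e be obtained from Γ by adjoining a new edge e with t(e) = v, h(e) = w. Then M(Γ^e)(z) = M(Γ)(z); moreover, if Γ has a unique minimal vertex * with |*| = 0, then the induced homomorphism A(i^e) : A(Γ) → A(Γ^e) is an isomorphism of F-algebras. -/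
open scoped BigOperators

namespace GLG

variable {V E : Type}

/-- Tail map of `Γ^e`: the new edge `none` has tail `v`. -/
def extTl (tl : E → V) (v : V) : Option E → V
  | none => v
  | some f => tl f

/-- Head map of `Γ^e`: the new edge `none` has head `w`. -/
def extHd (hd : E → V) (w : V) : Option E → V
  | none => w
  | some f => hd f

/-- The map on generators inducing `A(i^e) : A(Γ) → A(Γ^e)`: `a_j(f) ↦ a_j(f)` for
every `f ∈ E`. -/
noncomputable def extGen (F : Type) [Field F] (tl hd : E → V) (rk : V → ℕ) (v w : V) :
    ESharp tl hd rk → FreeAlgebra F (ESharp (extTl tl v) (extHd hd w) rk) :=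
  fun s => FreeAlgebra.ι F ⟨some s.1, ⟨s.2.1, s.2.2.1, s.2.2.2⟩⟩

end GLG

namespace GLG

variable {V E : Type}

def pth (tl hd : E → V) : V → V → List E → Prop
  | u, x, [] => u = x
  | u, x, e :: es => tl e = u ∧ pth tl hd (hd e) x es

theorem pth_iff (tl hd : E → V) (e : E) (es : List E) (u x : V) :
    (IsPathC tl hd e es ∧ tl e = u ∧ pathDst hd e es = x) ↔ pth tl hd u x (e :: es) := by
  induction es generalizing e u with
  | nil => simp [IsPathC, List.Chain, pathDst, pth]
  | cons f fs ih =>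
    have h := ih f (hd e)
    rw [pth, ← h]
    simp only [IsPathC, List.Chain, pathDst, List.isChain_cons_cons, List.getLast_cons_cons]
    constructor
    · rintro ⟨⟨h1, h2⟩, h3, h4⟩
      exact ⟨h3, h2, h1.symm, h4⟩
    · rintro ⟨h3, h2, h1, h4⟩
      exact ⟨⟨h1.symm, h2⟩, h3, h4⟩

theorem pth_append (tl hd : E → V) (u x y : V) (l1 l2 : List E)
    (h1 : pth tl hd u x l1) (h2 : pth tl hd x y l2) : pth tl hd u y (l1 ++ l2) := by
  induction l1 generalizing u with
  | nil => simp only [pth] at h1; subst h1; simpa using h2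
  | cons e es ih => exact ⟨h1.1, ih _ h1.2⟩

/-- Replace the new edge by a path. -/
def expand (p : List E) : List (Option E) → List E
  | [] => []
  | none :: l => p ++ expand p l
  | some f :: l => f :: expand p l

theorem pth_expand (tl hd : E → V) (v w : V) (p : List E) (hp : pth tl hd v w p)
    (l : List (Option E)) (u x : V) (h : pth (extTl tl v) (extHd hd w) u x l) :
    pth tl hd u x (expand p l) := by
  induction l generalizing u with
  | nil => exact h
  | cons o l ih =>
    cases o with
    | none =>
      obtain ⟨h1, h2⟩ := h
      have h1 : v = u := h1
      subst h1
      exact pth_append _ _ _ _ _ _ _ hp (ih _ h2)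
    | some f => exact ⟨h.1, ih _ h.2⟩

theorem expand_cons_ne (p : List E) (hp : p ≠ []) (o : Option E) (l : List (Option E)) :
    expand p (o :: l) ≠ [] := by
  cases o <;> simp [expand, hp]

theorem pth_some (tl hd : E → V) (v w : V) (l : List E) (u x : V) (h : pth tl hd u x l) :
    pth (extTl tl v) (extHd hd w) u x (l.map some) := by
  induction l generalizing u with
  | nil => exact h
  | cons f l ih => exact ⟨h.1, ih _ h.2⟩

theorem reaches_iff_s15 (tl hd : E → V) (u x : V) :
    Reaches tl hd u x ↔ ∃ l, l ≠ [] ∧ pth tl hd u x l := by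
  constructor
  · rintro ⟨e, es, h⟩
    exact ⟨e :: es, by simp, (pth_iff _ _ _ _ _ _).1 h⟩
  · rintro ⟨l, h0, h⟩
    cases l with
    | nil => exact absurd rfl h0
    | cons e es => exact ⟨e, es, (pth_iff _ _ _ _ _ _).2 h⟩

theorem reaches_ext (tl hd : E → V) (v w : V) (h : Reaches tl hd v w) :
    Reaches (extTl tl v) (extHd hd w) = Reaches tl hd := by
  funext u x
  apply propext
  obtain ⟨p, hp0, hp⟩ := (reaches_iff_s15 _ _ _ _).1 h
  rw [reaches_iff_s15, reaches_iff_s15]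
  constructor
  · rintro ⟨l, h0, h1⟩
    refine ⟨expand p l, ?_, pth_expand _ _ _ _ _ hp _ _ _ h1⟩
    cases l with
    | nil => exact absurd rfl h0
    | cons o l => exact expand_cons_ne _ hp0 _ _
  · rintro ⟨l, h0, h1⟩
    exact ⟨l.map some, by simpa using h0, pth_some _ _ _ _ _ _ _ h1⟩

theorem MGamma_ext (tl hd : E → V) (rk : V → ℕ) (v w : V) (h : Reaches tl hd v w) :
    MGamma (extTl tl v) (extHd hd w) rk = MGamma tl hd rk := by
  unfold MGamma mob GE
  rw [reaches_ext tl hd v w h]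

theorem pth_rk (tl hd : E → V) (rk : V → ℕ) (hr : IsRank tl hd rk) (l : List E) (u x : V)
    (h : pth tl hd u x l) : (l.map (len tl hd rk)).sum + rk x = rk u := by
  induction l generalizing u with
  | nil => simp only [pth] at h; simp [h]
  | cons e l ih =>
    obtain ⟨h1, h2⟩ := h
    have := ih _ h2
    have := hr e
    subst h1
    simp only [List.map_cons, List.sum_cons, len] at *
    omega

section alg
variable (F : Type) [Field F] (tl hd : E → V) (rk : V → ℕ)

theorem Pe_coeff_zero (e : E) : (Pe F tl hd rk e).coeff 0 = 1 := by
  unfold Pe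
  rw [Polynomial.coeff_add, Polynomial.finsetSum_coeff, Finset.sum_eq_zero]
  · simp
  · intro j _
    have := (Finset.mem_Icc.mp j.2).1
    rw [Polynomial.coeff_C_mul, Polynomial.coeff_X_pow, if_neg (by omega), mul_zero]

theorem Pe_coeff (e : E) (j : ℕ) (h : 1 ≤ j ∧ j ≤ len tl hd rk e) :
    (Pe F tl hd rk e).coeff j = (-1) ^ j * FreeAlgebra.ι F (⟨e, ⟨j, h⟩⟩ : ESharp tl hd rk) := by
  unfold Pe
  rw [Polynomial.coeff_add, Polynomial.finsetSum_coeff,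
    Finset.sum_eq_single (⟨j, Finset.mem_Icc.2 h⟩ : {x // x ∈ Finset.Icc 1 (len tl hd rk e)})]
  · rw [Polynomial.coeff_one, if_neg (by omega), zero_add, Polynomial.coeff_C_mul,
      Polynomial.coeff_X_pow, if_pos rfl, mul_one]
  · intro b _ hb
    have : j ≠ (b : ℕ) := fun hh => hb (Subtype.ext hh.symm)
    rw [Polynomial.coeff_C_mul, Polynomial.coeff_X_pow, if_neg this, mul_zero]
  · intro hh
    exact absurd (Finset.mem_attach _ _) hh

theorem Pe_natDegree (e : E) : (Pe F tl hd rk e).natDegree ≤ len tl hd rk e := by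
  unfold Pe
  refine (Polynomial.natDegree_add_le _ _).trans (max_le (by simp) ?_)
  refine Polynomial.natDegree_sum_le_of_forall_le _ _ ?_
  intro j _
  refine (Polynomial.natDegree_C_mul_X_pow_le _ _).trans (Finset.mem_Icc.mp j.2).2

theorem prod_natDegree (l : List E) :
    ((l.map (Pe F tl hd rk)).prod).natDegree ≤ (l.map (len tl hd rk)).sum := by
  induction l with
  | nil => simp
  | cons e l ih =>
    simp only [List.map_cons, List.prod_cons, List.sum_cons]
    exact Polynomial.natDegree_mul_le.trans (add_le_add (Pe_natDegree _ _ _ _ _) ih)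

theorem prod_coeff_zero (l : List E) : ((l.map (Pe F tl hd rk)).prod).coeff 0 = 1 := by
  induction l with
  | nil => simp
  | cons e l ih =>
    simp only [List.map_cons, List.prod_cons, Polynomial.mul_coeff_zero, ih, Pe_coeff_zero,
      mul_one]

theorem neg_one_sq (R : Type) [Ring R] (j : ℕ) (x : R) : (-1) ^ j * ((-1) ^ j * x) = x := by
  rw [← mul_assoc, ← pow_add, Even.neg_one_pow ⟨j, rfl⟩, one_mul]

theorem eP_single (e : E) (j : ℕ) (h : 1 ≤ j ∧ j ≤ len tl hd rk e) :
    eP F tl hd rk [e] j = FreeAlgebra.ι F (⟨e, ⟨j, h⟩⟩ : ESharp tl hd rk) := by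
  unfold eP
  rw [List.map_singleton, List.prod_singleton, Pe_coeff F tl hd rk e j h, neg_one_sq]

/-- two polynomials of bounded degree with equal coefficients. -/
theorem poly_ext_le {R : Type} [Ring R] (p q : Polynomial R) (n : ℕ) (hp : p.natDegree ≤ n)
    (hq : q.natDegree ≤ n) (h0 : p.coeff 0 = q.coeff 0)
    (h : ∀ j, 1 ≤ j ∧ j ≤ n → p.coeff j = q.coeff j) : p = q := by
  ext j
  by_cases hj : n < j
  · rw [Polynomial.coeff_eq_zero_of_natDegree_lt (by omega),
      Polynomial.coeff_eq_zero_of_natDegree_lt (by omega)]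
  · rcases Nat.eq_zero_or_pos j with rfl | h1
    · exact h0
    · exact h j ⟨h1, by omega⟩

variable (v w : V) (p : List E)

/-- the inverse on generators -/
noncomputable def backGen :
    ESharp (extTl tl v) (extHd hd w) rk → FreeAlgebra F (ESharp tl hd rk)
  | ⟨none, j⟩ => eP F tl hd rk p j.1
  | ⟨some f, j⟩ => FreeAlgebra.ι F ⟨f, ⟨j.1, j.2.1, j.2.2⟩⟩

noncomputable def back : FreeAlgebra F (ESharp (extTl tl v) (extHd hd w) rk) →ₐ[F]
    FreeAlgebra F (ESharp tl hd rk) := FreeAlgebra.lift F (backGen F tl hd rk v w p)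

theorem back_Pe_some (f : E) :
    (Pe F (extTl tl v) (extHd hd w) rk (some f)).map (back F tl hd rk v w p : _ →+* _)
      = Pe F tl hd rk f := by
  refine poly_ext_le _ _ (len tl hd rk f)
    (Polynomial.natDegree_map_le.trans (Pe_natDegree _ _ _ _ _)) (Pe_natDegree _ _ _ _ _) ?_ ?_
  · rw [Polynomial.coeff_map, Pe_coeff_zero, Pe_coeff_zero, map_one]
  · intro j hj
    rw [Polynomial.coeff_map, Pe_coeff _ _ _ _ _ _ hj, Pe_coeff _ _ _ _ (some f) _ hj]
    simp [back, backGen]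

theorem back_Pe_none (hr : IsRank tl hd rk) (hp : pth tl hd v w p) :
    (Pe F (extTl tl v) (extHd hd w) rk none).map (back F tl hd rk v w p : _ →+* _)
      = (p.map (Pe F tl hd rk)).prod := by
  have h1 := pth_rk tl hd rk hr p v w hp
  have h2 : len (extTl tl v) (extHd hd w) rk none = (p.map (len tl hd rk)).sum := by
    change rk v - rk w = _
    omega
  refine poly_ext_le _ _ (len (extTl tl v) (extHd hd w) rk none)
    (Polynomial.natDegree_map_le.trans (Pe_natDegree _ _ _ _ _))
    (h2 ▸ prod_natDegree F tl hd rk p) ?_ ?_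
  · rw [Polynomial.coeff_map, Pe_coeff_zero, prod_coeff_zero, map_one]
  · intro j hj
    rw [Polynomial.coeff_map, Pe_coeff _ _ _ _ none _ hj]
    simp only [back, RingHom.coe_coe, map_mul, map_pow, map_neg, map_one,
      FreeAlgebra.lift_ι_apply, backGen, eP]
    rw [neg_one_sq]

theorem back_prod (hr : IsRank tl hd rk) (hp : pth tl hd v w p) (l : List (Option E)) :
    ((l.map (Pe F (extTl tl v) (extHd hd w) rk)).prod).map (back F tl hd rk v w p : _ →+* _)
      = ((expand p l).map (Pe F tl hd rk)).prod := by
  induction l with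
  | nil => simp [expand]
  | cons o l ih =>
    rw [List.map_cons, List.prod_cons, Polynomial.map_mul, ih]
    cases o with
    | none => rw [back_Pe_none F tl hd rk v w p hr hp]; simp [expand]
    | some f => rw [back_Pe_some]; simp [expand]

theorem back_eP (hr : IsRank tl hd rk) (hp : pth tl hd v w p) (l : List (Option E)) (j : ℕ) :
    back F tl hd rk v w p (eP F (extTl tl v) (extHd hd w) rk l j)
      = eP F tl hd rk (expand p l) j := by
  unfold eP
  rw [← back_prod F tl hd rk v w p hr hp l, Polynomial.coeff_map]
  simp

theorem expand_some (l : List E) : expand p (l.map some) = l := by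
  induction l with
  | nil => rfl
  | cons e l ih => simp [expand, ih]

theorem mkA_eP_eq (l1 l2 : List E) (h1 : l1 ≠ []) (h2 : l2 ≠ []) (u x : V)
    (hp1 : pth tl hd u x l1) (hp2 : pth tl hd u x l2) (j : ℕ) (hj : 1 ≤ j ∧ j ≤ rk u - rk x) :
    mkA F tl hd rk (eP F tl hd rk l1 j) = mkA F tl hd rk (eP F tl hd rk l2 j) := by
  cases l1 with
  | nil => exact absurd rfl h1
  | cons e1 es1 =>
  cases l2 with
  | nil => exact absurd rfl h2
  | cons e2 es2 =>
  obtain ⟨a1, b1, c1⟩ := (pth_iff _ _ _ _ _ _).2 hp1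
  obtain ⟨a2, b2, c2⟩ := (pth_iff _ _ _ _ _ _).2 hp2
  refine RingQuot.mkAlgHom_rel F ⟨e1, es1, e2, es2, j, a1, a2, b1.trans b2.symm,
    c1.trans c2.symm, hj.1, ?_, rfl, rfl⟩
  rw [b1, c1]
  exact hj.2

/-- the inverse homomorphism -/
theorem exists_psi (hr : IsRank tl hd rk) (hp : pth tl hd v w p) (hp0 : p ≠ []) :
    ∃ ψ : AGamma F (extTl tl v) (extHd hd w) rk →ₐ[F] AGamma F tl hd rk,
      ∀ x, ψ (mkA F (extTl tl v) (extHd hd w) rk x) = mkA F tl hd rk (back F tl hd rk v w p x) := by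
  refine ⟨RingQuot.liftAlgHom F ⟨(mkA F tl hd rk).comp (back F tl hd rk v w p), ?_⟩, ?_⟩
  · rintro x y ⟨e1, es1, e2, es2, j, a1, a2, b, c, hj1, hj2, rfl, rfl⟩
    have q1 := (pth_iff _ _ _ _ _ _).1 ⟨a1, rfl, rfl⟩
    have q2 := (pth_iff _ _ _ _ _ _).1 ⟨a2, b.symm, c.symm⟩
    simp only [AlgHom.comp_apply, back_eP F tl hd rk v w p hr hp]
    exact mkA_eP_eq F tl hd rk _ _ (expand_cons_ne _ hp0 _ _) (expand_cons_ne _ hp0 _ _) _ _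
      (pth_expand _ _ _ _ _ hp _ _ _ q1) (pth_expand _ _ _ _ _ hp _ _ _ q2) j ⟨hj1, hj2⟩
  · intro x
    exact RingQuot.liftAlgHom_mkAlgHom_apply F
      ((mkA F tl hd rk).comp (back F tl hd rk v w p)) _ x

theorem mkA_surj : Function.Surjective (mkA F tl hd rk) := RingQuot.mkAlgHom_surjective _ _

theorem back_ext (x : FreeAlgebra F (ESharp tl hd rk)) :
    back F tl hd rk v w p (FreeAlgebra.lift F (extGen F tl hd rk v w) x) = x := by
  have : (back F tl hd rk v w p).comp (FreeAlgebra.lift F (extGen F tl hd rk v w))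
      = AlgHom.id F _ := by
    apply FreeAlgebra.hom_ext
    funext s
    simp [back, extGen, backGen]
  exact DFunLike.congr_fun this x

theorem ext_Pe (f : E) :
    (Pe F tl hd rk f).map (FreeAlgebra.lift F (extGen F tl hd rk v w) : _ →+* _)
      = Pe F (extTl tl v) (extHd hd w) rk (some f) := by
  refine poly_ext_le _ _ (len tl hd rk f)
    (Polynomial.natDegree_map_le.trans (Pe_natDegree _ _ _ _ _)) (Pe_natDegree _ _ _ _ _) ?_ ?_
  · rw [Polynomial.coeff_map, Pe_coeff_zero, Pe_coeff_zero, map_one]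
  · intro j hj
    rw [Polynomial.coeff_map, Pe_coeff _ _ _ _ _ _ hj, Pe_coeff _ _ _ _ (some f) _ hj]
    simp [extGen]

theorem ext_eP (l : List E) (j : ℕ) :
    FreeAlgebra.lift F (extGen F tl hd rk v w) (eP F tl hd rk l j)
      = eP F (extTl tl v) (extHd hd w) rk (l.map some) j := by
  have h : ((l.map (Pe F tl hd rk)).prod).map
      (FreeAlgebra.lift F (extGen F tl hd rk v w) : _ →+* _)
      = ((l.map some).map (Pe F (extTl tl v) (extHd hd w) rk)).prod := by
    induction l with
    | nil => simp
    | cons e l ih =>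
      rw [List.map_cons, List.prod_cons, Polynomial.map_mul, ih, ext_Pe]
      simp
  unfold eP
  rw [← h, Polynomial.coeff_map]
  simp

theorem ext_back (hp : pth tl hd v w p) (hp0 : p ≠ [])
    (x : FreeAlgebra F (ESharp (extTl tl v) (extHd hd w) rk)) :
    mkA F (extTl tl v) (extHd hd w) rk
      (FreeAlgebra.lift F (extGen F tl hd rk v w) (back F tl hd rk v w p x))
    = mkA F (extTl tl v) (extHd hd w) rk x := by
  have : ((mkA F (extTl tl v) (extHd hd w) rk).comp
      (FreeAlgebra.lift F (extGen F tl hd rk v w))).comp (back F tl hd rk v w p)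
      = mkA F (extTl tl v) (extHd hd w) rk := by
    apply FreeAlgebra.hom_ext
    funext s
    obtain ⟨o, j, hj⟩ := s
    cases o with
    | some f => simp [back, extGen, backGen]
    | none =>
      simp only [Function.comp_apply, AlgHom.comp_apply, back, FreeAlgebra.lift_ι_apply, backGen]
      rw [ext_eP, ← eP_single F (extTl tl v) (extHd hd w) rk none j hj]
      have hn : pth (extTl tl v) (extHd hd w) v w [none] := And.intro rfl rfl
      exact mkA_eP_eq F _ _ rk _ _ (by simpa using hp0) (by simp) v w
        (pth_some _ _ _ _ _ _ _ hp) hn j hj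
  exact DFunLike.congr_fun this x

end alg

end GLG

/-- **Corollary 5.3.** Let `Γ` be a finite generalized layered graph, let
`v, w` be vertices with `|v| > |w|` such that there is a directed path in `Γ` from `v` to
`w`, and let `Γ^e` be obtained from `Γ` by adjoining a new edge `e` with `t(e) = v`,
`h(e) = w`.  Then `M(Γ^e)(z) = M(Γ)(z)`; moreover, if `Γ` has a unique minimal vertex `*`
with `|*| = 0`, then the induced homomorphism `A(i^e) : A(Γ) → A(Γ^e)` is an isomorphism of
`F`-algebras. -/
theorem MGamma_add_edge_of_reaches (F : Type) [Field F] {V E : Type} [Fintype V] [Fintype E]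
    (tl hd : E → V) (rk : V → ℕ) (hrank : GLG.IsRank tl hd rk)
    (v w : V) (hvw : rk w < rk v) (hreach : GLG.Reaches tl hd v w) :
    GLG.MGamma (GLG.extTl tl v) (GLG.extHd hd w) rk = GLG.MGamma tl hd rk ∧
      ∀ star : V, rk star = 0 → (∀ u : V, (∀ e : E, tl e ≠ u) ↔ u = star) →
        ∀ φ : GLG.AGamma F tl hd rk →ₐ[F]
            GLG.AGamma F (GLG.extTl tl v) (GLG.extHd hd w) rk,
          (∀ x : FreeAlgebra F (GLG.ESharp tl hd rk),
            φ (GLG.mkA F tl hd rk x) =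
              GLG.mkA F (GLG.extTl tl v) (GLG.extHd hd w) rk
                (FreeAlgebra.lift F (GLG.extGen F tl hd rk v w) x)) →
          Function.Bijective φ := by
  refine ⟨GLG.MGamma_ext tl hd rk v w hreach, ?_⟩
  intro star _ _ φ hφ
  obtain ⟨p, hp0, hp⟩ := (GLG.reaches_iff_s15 _ _ _ _).1 hreach
  obtain ⟨ψ, hψ⟩ := GLG.exists_psi F tl hd rk v w p hrank hp hp0
  refine Function.bijective_iff_has_inverse.2 ⟨ψ, ?_, ?_⟩
  · intro a
    obtain ⟨x, rfl⟩ := GLG.mkA_surj F tl hd rk a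
    rw [hφ, hψ, GLG.back_ext]
  · intro a
    obtain ⟨x, rfl⟩ := GLG.mkA_surj F _ _ rk a
    rw [hψ, hφ, GLG.ext_back F tl hd rk v w p hp hp0]
end

section
/- Let Γ be a finite generalized layered graph with a unique maximal vertex of rank n and a unique minimal vertex of rank 0, and let Γ̌ be the inverted graph: it has the same vertex set with rank |v̌| = n − |v|, and for each edge e ∈ E an edge ě with t(ě) = h(e) and h(ě) = t(e). Then M(Γ̌)(z) = M(Γ)(z), and the Hilbert series satisfy H(A(Γ̌),z) = H(A(Γ),z). -/
open scoped BigOperators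

namespace GLG

variable {V E : Type}

lemma path_rev (tl hd : E → V) (e : E) (es : List E) (h : IsPathC tl hd e es) :
    ∃ e' es', (e :: es).reverse = e' :: es' ∧ IsPathC hd tl e' es' ∧
      hd e' = pathDst hd e es ∧ pathDst tl e' es' = tl e := by
  obtain ⟨e', es', heq⟩ : ∃ e' es', (e :: es).reverse = e' :: es' := by
    cases hr : (e :: es).reverse with
    | nil => simp at hr
    | cons a l => exact ⟨a, l, rfl⟩
  have h2 : e :: es = (e' :: es').reverse := by rw [← heq, List.reverse_reverse]
  refine ⟨e', es', heq, ?_, ?_, ?_⟩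
  · have h1 : List.IsChain (fun a b => hd a = tl b) (e :: es) := h
    show List.IsChain (fun a b => tl a = hd b) (e' :: es')
    rw [← heq, List.isChain_reverse]
    refine h1.imp ?_
    intro a b hab
    exact hab.symm
  · unfold pathDst
    congr 1
    have : (e :: es).getLast? = some e' := by rw [h2]; simp
    rw [List.getLast?_eq_getLast_of_ne_nil (List.cons_ne_nil e es)] at this
    exact (Option.some.inj this).symm
  · unfold pathDst
    congr 1
    have : (e' :: es').getLast? = some e := by rw [← heq]; simp
    rw [List.getLast?_eq_getLast_of_ne_nil (List.cons_ne_nil e' es')] at this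
    exact (Option.some.inj this)

lemma reaches_rev (tl hd : E → V) (v w : V) (h : Reaches tl hd v w) : Reaches hd tl w v := by
  obtain ⟨e, es, hp, h1, h2⟩ := h
  obtain ⟨e', es', -, hp', h3, h4⟩ := path_rev tl hd e es hp
  exact ⟨e', es', hp', h3.trans h2, h4.trans h1⟩

lemma reaches_iff_s16 (tl hd : E → V) (v w : V) : Reaches hd tl w v ↔ Reaches tl hd v w :=
  ⟨reaches_rev hd tl w v, reaches_rev tl hd v w⟩

lemma mob_rev (tl hd : E → V) (v w : V) : mob hd tl w v = mob tl hd v w := by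
  unfold mob
  refine finsum_mem_eq_of_bijOn List.reverse ?_ ?_
  · have key : ∀ (tl hd : E → V) (v w : V) (c : List V),
        (c.Chain' (Reaches hd tl) ∧ c.head? = some w ∧ c.getLast? = some v) →
        (c.reverse.Chain' (Reaches tl hd) ∧ c.reverse.head? = some v ∧
          c.reverse.getLast? = some w) := by
      intro tl hd v w c hc
      obtain ⟨h1, h2, h3⟩ := hc
      refine ⟨?_, by simpa using h3, by simpa using h2⟩
      have h1' : List.IsChain (Reaches hd tl) c := h1
      show List.IsChain (Reaches tl hd) c.reverse
      rw [List.isChain_reverse]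
      exact h1'.imp fun a b hab => reaches_rev hd tl a b hab
    refine ⟨fun c hc => key tl hd v w c hc, List.reverse_injective.injOn, ?_⟩
    intro c hc
    exact ⟨c.reverse, key hd tl w v c hc, List.reverse_reverse c⟩
  · intro c _
    simp

lemma MGamma_rev (tl hd : E → V) (rk rk' : V → ℕ)
    (H : ∀ v w, rk v - rk w = rk' w - rk' v) : MGamma hd tl rk' = MGamma tl hd rk := by
  unfold MGamma
  refine finsum_mem_eq_of_bijOn Prod.swap ?_ ?_
  · refine ⟨?_, Prod.swap_injective.injOn, ?_⟩
    · rintro ⟨a, b⟩ h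
      rcases h with h | h
      · exact Or.inl h.symm
      · exact Or.inr (reaches_rev _ _ _ _ h)
    · rintro ⟨a, b⟩ h
      refine ⟨(b, a), ?_, rfl⟩
      rcases h with h | h
      · exact Or.inl h.symm
      · exact Or.inr (reaches_rev _ _ _ _ h)
  · rintro ⟨a, b⟩ _
    simp only [Prod.swap, Prod.fst_swap, Prod.snd_swap]
    rw [mob_rev, H]

open MulOpposite

section
variable (F : Type) [Field F] (tl hd : E → V) (rk rk' : V → ℕ)
    (H : ∀ v w, rk v - rk w = rk' w - rk' v)

def gen (s : ESharp tl hd rk) : ESharp hd tl rk' :=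
  ⟨s.1, ⟨s.2.1, s.2.2.1, by have := s.2.2.2; unfold len at *; rw [← H]; exact this⟩⟩

noncomputable def psi : FreeAlgebra F (ESharp tl hd rk) →ₐ[F]
    (FreeAlgebra F (ESharp hd tl rk'))ᵐᵒᵖ :=
  FreeAlgebra.lift F (fun s => op (FreeAlgebra.ι F (gen tl hd rk rk' H s)))

lemma psi_Pe (e : E) : Polynomial.map (psi F tl hd rk rk' H).toRingHom (Pe F tl hd rk e) =
    Polynomial.opRingEquiv _ (op (Pe F hd tl rk' e)) := by
  unfold Pe
  rw [Polynomial.map_add, op_add, map_add, Polynomial.map_sum, Finset.op_sum, map_sum]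
  congr 1
  · simp
  · have hl : len tl hd rk e = len hd tl rk' e := H _ _
    refine Finset.sum_bij (fun j _ => ⟨j.1, by rw [← hl]; exact j.2⟩) ?_ ?_ ?_ ?_
    · intro a _; simp
    · intro a _ b _ h
      exact Subtype.ext (Subtype.mk.inj h)
    · intro b _
      exact ⟨⟨b.1, by rw [hl]; exact b.2⟩, by simp, rfl⟩
    · intro j _
      rw [Polynomial.opRingEquiv_op_C_mul_X_pow, Polynomial.map_mul, Polynomial.map_C,
        Polynomial.map_pow, Polynomial.map_X]
      congr 2
      show psi F tl hd rk rk' H _ = _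
      rw [map_mul, map_pow, map_neg, map_one, op_mul, op_pow, op_neg, op_one]
      rw [show psi F tl hd rk rk' H (FreeAlgebra.ι F _) = _ from FreeAlgebra.lift_ι_apply _ _]
      rw [((Commute.neg_one_left _).pow_left _).eq]
      rfl

lemma psi_prod (es : List E) : Polynomial.map (psi F tl hd rk rk' H).toRingHom
      (es.map (Pe F tl hd rk)).prod =
    Polynomial.opRingEquiv _ (op (es.reverse.map (Pe F hd tl rk')).prod) := by
  induction es with
  | nil => simp
  | cons e es ih =>
    rw [List.map_cons, List.prod_cons, Polynomial.map_mul, ih, psi_Pe]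
    simp

lemma psi_eP (es : List E) (j : ℕ) : psi F tl hd rk rk' H (eP F tl hd rk es j) =
    op (eP F hd tl rk' es.reverse j) := by
  unfold eP
  have h := congrArg (fun p => Polynomial.coeff p j) (psi_prod F tl hd rk rk' H es)
  simp only [Polynomial.coeff_map, Polynomial.coeff_opRingEquiv, unop_op] at h
  rw [map_mul, map_pow, map_neg, map_one, op_mul, op_pow, op_neg, op_one, ← h]
  exact ((Commute.neg_one_left _).pow_left _).eq

lemma rel_rev (x y : FreeAlgebra F (ESharp tl hd rk)) (h : rel F tl hd rk x y) :
    rel F hd tl rk' (unop (psi F tl hd rk rk' H x)) (unop (psi F tl hd rk rk' H y)) := by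
  obtain ⟨e1, es1, e2, es2, j, p1, p2, ht, hh, j1, j2, rfl, rfl⟩ := h
  obtain ⟨a1, b1, r1, q1, s1, t1⟩ := path_rev tl hd e1 es1 p1
  obtain ⟨a2, b2, r2, q2, s2, t2⟩ := path_rev tl hd e2 es2 p2
  refine ⟨a1, b1, a2, b2, j, q1, q2, ?_, ?_, j1, ?_, ?_, ?_⟩
  · rw [s1, s2, hh]
  · rw [t1, t2, ht]
  · rw [s1, t1, ← H]; exact j2
  · rw [psi_eP, r1, unop_op]
  · rw [psi_eP, r2, unop_op]

noncomputable def phi : AGamma F tl hd rk →ₐ[F] (AGamma F hd tl rk')ᵐᵒᵖ :=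
  RingQuot.liftAlgHom F
    ⟨(AlgHom.op (mkA F hd tl rk')).comp (psi F tl hd rk rk' H), by
      intro x y h
      show op (mkA F hd tl rk' (unop (psi F tl hd rk rk' H x))) =
        op (mkA F hd tl rk' (unop (psi F tl hd rk rk' H y)))
      congr 1
      exact RingQuot.mkAlgHom_rel F (rel_rev F tl hd rk rk' H x y h)⟩

lemma phi_ι (s : ESharp tl hd rk) : phi F tl hd rk rk' H (mkA F tl hd rk (FreeAlgebra.ι F s)) =
    op (mkA F hd tl rk' (FreeAlgebra.ι F (gen tl hd rk rk' H s))) := by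
  have h0 : phi F tl hd rk rk' H (mkA F tl hd rk (FreeAlgebra.ι F s)) =
      (AlgHom.op (mkA F hd tl rk')).comp (psi F tl hd rk rk' H) (FreeAlgebra.ι F s) :=
    RingQuot.liftAlgHom_mkAlgHom_apply _ _ _ _
  rw [h0]
  show op (mkA F hd tl rk' (unop (psi F tl hd rk rk' H (FreeAlgebra.ι F s)))) = _
  rw [show psi F tl hd rk rk' H (FreeAlgebra.ι F s) = _ from FreeAlgebra.lift_ι_apply _ _]
  rfl

lemma phi_word (w : List (ESharp tl hd rk)) :
    phi F tl hd rk rk' H (mkA F tl hd rk ((w.map (FreeAlgebra.ι F)).prod)) =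
    op (mkA F hd tl rk' ((((w.map (gen tl hd rk rk' H)).reverse).map (FreeAlgebra.ι F)).prod)) := by
  induction w with
  | nil => simp
  | cons s w ih =>
    rw [List.map_cons, List.prod_cons, map_mul, map_mul, ih, phi_ι]
    simp

noncomputable def lam : AGamma F tl hd rk →ₗ[F] AGamma F hd tl rk' :=
  (MulOpposite.opLinearEquiv F).symm.toLinearMap ∘ₗ (phi F tl hd rk rk' H).toLinearMap

lemma lam_apply (x : AGamma F tl hd rk) :
    lam F tl hd rk rk' H x = unop (phi F tl hd rk rk' H x) := rfl

lemma lam_lam (H' : ∀ v w, rk' v - rk' w = rk w - rk v) (x : AGamma F tl hd rk) :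
    lam F hd tl rk' rk H' (lam F tl hd rk rk' H x) = x := by
  have : ((AlgHom.opComm (phi F hd tl rk' rk H')).comp (phi F tl hd rk rk' H)) =
      AlgHom.id F _ := by
    apply RingQuot.ringQuot_ext' F
    apply FreeAlgebra.hom_ext
    funext s
    show unop (phi F hd tl rk' rk H' (unop (phi F tl hd rk rk' H
      (mkA F tl hd rk (FreeAlgebra.ι F s))))) = mkA F tl hd rk (FreeAlgebra.ι F s)
    rw [phi_ι, unop_op, phi_ι, unop_op]
    rfl
  exact DFunLike.congr_fun this x

lemma lam_gpiece (k : ℕ) :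
    (gpiece F tl hd rk k).map (lam F tl hd rk rk' H) ≤ gpiece F hd tl rk' k := by
  unfold gpiece
  rw [Submodule.map_span, Submodule.span_le]
  rintro _ ⟨_, ⟨w, hw, rfl⟩, rfl⟩
  apply Submodule.subset_span
  refine ⟨(w.map (gen tl hd rk rk' H)).reverse, ?_, ?_⟩
  · rw [← hw, List.map_reverse, List.sum_reverse, List.map_map]
    rfl
  · rw [lam_apply, phi_word, unop_op]

lemma hilb_rev (H : ∀ v w, rk v - rk w = rk' w - rk' v) : hilb F hd tl rk' = hilb F tl hd rk := by
  have H' : ∀ v w, rk' v - rk' w = rk w - rk v := fun v w => (H w v).symm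
  unfold hilb
  congr 1
  funext k
  congr 1
  let L : AGamma F tl hd rk ≃ₗ[F] AGamma F hd tl rk' :=
    { lam F tl hd rk rk' H with
      invFun := lam F hd tl rk' rk H'
      left_inv := lam_lam F tl hd rk rk' H H'
      right_inv := lam_lam F hd tl rk' rk H' H }
  have hm : (gpiece F tl hd rk k).map (L : AGamma F tl hd rk →ₗ[F] AGamma F hd tl rk') =
      gpiece F hd tl rk' k := by
    apply le_antisymm
    · exact lam_gpiece F tl hd rk rk' H k
    · intro x hx
      exact ⟨lam F hd tl rk' rk H' x,
        lam_gpiece F hd tl rk' rk H' k (Submodule.mem_map_of_mem hx),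
        lam_lam F hd tl rk' rk H' H x⟩
  rw [← hm]
  exact LinearEquiv.finrank_map_eq L _

end

end GLG

/-- **Proposition 5.4.** Let `Γ` be a finite generalized layered graph with a
unique maximal vertex of rank `n` and a unique minimal vertex of rank `0`, and let `Γ̌` be
the inverted graph (same vertices with rank `n - |v|`, and every edge reversed).  Then
`M(Γ̌)(z) = M(Γ)(z)` and `H(A(Γ̌),z) = H(A(Γ),z)`. -/
theorem inverted_graph_M_and_hilb (F : Type) [Field F] {V E : Type} [Fintype V] [Fintype E]
    (tl hd : E → V) (rk : V → ℕ) (hrank : GLG.IsRank tl hd rk)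
    (n : ℕ) (top : V) (htop : rk top = n)
    (hmax : ∀ v : V, (∀ e : E, hd e ≠ v) ↔ v = top)
    (star : V) (hstar0 : rk star = 0)
    (hmin : ∀ v : V, (∀ e : E, tl e ≠ v) ↔ v = star) :
    GLG.MGamma hd tl (fun v => n - rk v) = GLG.MGamma tl hd rk ∧
      GLG.hilb F hd tl (fun v => n - rk v) = GLG.hilb F tl hd rk := by
  have hle : ∀ v, rk v ≤ n := by
    obtain ⟨m, hm⟩ : ∃ m, ∀ v, rk v ≤ rk m := by
      haveI : Nonempty V := ⟨top⟩
      exact Finite.exists_max rk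
    have : m = top := by
      rw [← hmax]
      intro e he
      have h1 := hrank e
      have h2 := hm (tl e)
      rw [he] at h1
      omega
    intro v
    rw [← htop, ← this]
    exact hm v
  have H : ∀ v w, rk v - rk w = (fun v => n - rk v) w - (fun v => n - rk v) v := by
    intro v w
    have h1 := hle v
    have h2 := hle w
    show rk v - rk w = (n - rk w) - (n - rk v)
    omega
  exact ⟨GLG.MGamma_rev tl hd rk _ H, GLG.hilb_rev F tl hd rk _ H⟩
end
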